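/- arXiv:2404.17256 — 2 statements merged into one kernel-verified Lean document; each statement's English description precedes it below -/
import Mathlib

section
/- Let G be a finite abelian group, k a field whose characteristic does not divide |G|, and V a nontrivial finite-dimensional representation of G over k. Then γ^r(G,V) = 2 if and only if every nontrivial character of G occurring in the base change of V to an algebraic closure of k is an involution (i.e. squares to the trivial character); otherwise γ^r(G,V) ≥ 3. -/
open MvPolynomial

noncomputable section

variable {k : Type} [Field k] {N : ℕ} {G : Type}

def mAct (M : Matrix (Fin N) (Fin N) k) :
    MvPolynomial (Fin N) k →ₐ[k] MvPolynomial (Fin N) k :=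
  aeval fun i => ∑ j, C (M i j) * X j

lemma mAct_comp (A B : Matrix (Fin N) (Fin N) k) :
    (mAct A).comp (mAct B) = mAct (B * A) := by
  apply MvPolynomial.algHom_ext
  intro i
  simp only [mAct, AlgHom.comp_apply, aeval_X, map_sum, map_mul, aeval_C, algebraMap_eq,
    Finset.mul_sum, Matrix.mul_apply, Finset.sum_mul]
  rw [Finset.sum_comm]
  simp [mul_assoc]

lemma mAct_one : mAct (1 : Matrix (Fin N) (Fin N) k) = AlgHom.id k _ := by
  apply MvPolynomial.algHom_ext
  intro i
  simp [mAct, Matrix.one_apply, ite_mul, apply_ite C]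

def mEquiv (M : GL (Fin N) k) :
    MvPolynomial (Fin N) k ≃ₐ[k] MvPolynomial (Fin N) k :=
  AlgEquiv.ofAlgHom (mAct (M : Matrix (Fin N) (Fin N) k))
    (mAct ((M⁻¹ : GL (Fin N) k) : Matrix (Fin N) (Fin N) k))
    (by rw [mAct_comp, Units.inv_mul, mAct_one])
    (by rw [mAct_comp, Units.mul_inv, mAct_one])

def fAct (M : GL (Fin N) k) :
    FractionRing (MvPolynomial (Fin N) k) ≃+* FractionRing (MvPolynomial (Fin N) k) :=
  IsFractionRing.ringEquivOfRingEquiv (mEquiv M).toRingEquiv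

/-- `f` is an invariant rational function for the linear action `ρ`. -/
def IsInv (ρ : G → GL (Fin N) k) (f : FractionRing (MvPolynomial (Fin N) k)) : Prop :=
  ∀ g, fAct (ρ g) f = f

/-- `f`, written as a quotient `f₁/f₂` of coprime polynomials, has
`deg f = deg f₁ + deg f₂ ≤ d`. -/
def RDegLE (f : FractionRing (MvPolynomial (Fin N) k)) (d : ℕ) : Prop :=
  ∃ f₁ f₂ : MvPolynomial (Fin N) k, f₂ ≠ 0 ∧
    (∀ p : MvPolynomial (Fin N) k, p ∣ f₁ → p ∣ f₂ → IsUnit p) ∧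
    f = algebraMap (MvPolynomial (Fin N) k) (FractionRing (MvPolynomial (Fin N) k)) f₁ /
        algebraMap (MvPolynomial (Fin N) k) (FractionRing (MvPolynomial (Fin N) k)) f₂ ∧
    f₁.totalDegree + f₂.totalDegree ≤ d

/-- `f` is (the image in `k(V)` of) a polynomial of degree at most `d`. -/
def PDegLE (f : FractionRing (MvPolynomial (Fin N) k)) (d : ℕ) : Prop :=
  ∃ p : MvPolynomial (Fin N) k, p.totalDegree ≤ d ∧
    f = algebraMap (MvPolynomial (Fin N) k) (FractionRing (MvPolynomial (Fin N) k)) p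

/-- `β^r(G,V)`: the least `d` such that the invariant rational functions of degree at most `d`
generate the invariant field over `k`. -/
def betaR (ρ : G → GL (Fin N) k) : ℕ :=
  sInf {d : ℕ | ∀ f, IsInv ρ f →
    f ∈ IntermediateField.adjoin k {h | IsInv ρ h ∧ RDegLE h d}}

/-- `β(G,V)`: the least `d` such that the invariant polynomials of degree at most `d`
generate the invariant field over `k`. -/
def betaP (ρ : G → GL (Fin N) k) : ℕ :=
  sInf {d : ℕ | ∀ f, IsInv ρ f →
    f ∈ IntermediateField.adjoin k {h | IsInv ρ h ∧ PDegLE h d}}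

/-- `γ^r(G,V)`: the least `d` such that the invariant rational functions of degree at most `d`
contain a transcendence basis for the invariant field over `k`. -/
def gammaR (ρ : G → GL (Fin N) k) : ℕ :=
  sInf {d : ℕ | ∃ s : Set (FractionRing (MvPolynomial (Fin N) k)),
    (∀ f ∈ s, IsInv ρ f ∧ RDegLE f d) ∧
    AlgebraicIndependent k ((↑) : s → FractionRing (MvPolynomial (Fin N) k)) ∧
    ∀ f, IsInv ρ f → IsAlgebraic (IntermediateField.adjoin k s) f}

/-- `γ(G,V)`: the least `d` such that the invariant polynomials of degree at most `d`
contain a transcendence basis for the invariant field over `k`. -/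
def gammaP (ρ : G → GL (Fin N) k) : ℕ :=
  sInf {d : ℕ | ∃ s : Set (FractionRing (MvPolynomial (Fin N) k)),
    (∀ f ∈ s, IsInv ρ f ∧ PDegLE f d) ∧
    AlgebraicIndependent k ((↑) : s → FractionRing (MvPolynomial (Fin N) k)) ∧
    ∀ f, IsInv ρ f → IsAlgebraic (IntermediateField.adjoin k s) f}

/-- The character `χ : G → Lˣ` occurs in the base change to `L` of the representation `ρ`,
i.e. its eigenspace in `L ⊗ V` is nonzero. -/
def Occurs {L : Type} [Field L] [Algebra k L] [Monoid G] (ρ : G → GL (Fin N) k)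
    (χ : G →* Lˣ) : Prop :=
  ∃ v : Fin N → L, v ≠ 0 ∧
    ∀ g, ((ρ g : Matrix (Fin N) (Fin N) k).map (algebraMap k L)).mulVec v = (χ g : L) • v


lemma diag_aux {F : Type} [Field F] {N : ℕ} {G : Type} [CommGroup G] (ρ : G →* GL (Fin N) F)
    (n : ℕ) (hn : (n : F) ≠ 0) (hρ : ∀ g, ρ g ^ n = 1)
    (htop : ∀ g, ⨆ μ : F, Module.End.maxGenEigenspace (Matrix.toLin' (ρ g : Matrix (Fin N) (Fin N) F)) μ = ⊤) :
    ∃ (S : GL (Fin N) F) (χ : Fin N → G →* Fˣ), ∀ g,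
      (ρ g : Matrix (Fin N) (Fin N) F) * S = S * Matrix.diagonal (fun j => (χ j g : F)) := by
  classical
  set f : G → Module.End F (Fin N → F) := fun g => Matrix.toLin' (ρ g : Matrix (Fin N) (Fin N) F) with hf
  have hfmul : ∀ g h, f (g * h) = f g * f h := by
    intro g h
    simp [hf, Matrix.toLin'_mul, Module.End.mul_eq_comp]
  have hf1 : f 1 = 1 := by
    simp [hf]; rfl
  have hss : ∀ g, (f g).IsSemisimple := by
    intro g
    apply Module.End.isSemisimple_of_squarefree_aeval_eq_zero
      (p := (Polynomial.X ^ n - Polynomial.C (1 : F)))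
    · exact (Polynomial.separable_X_pow_sub_C (1 : F) hn one_ne_zero).squarefree
    · have h1 : ∀ m : ℕ, f g ^ m = f (g ^ m) := by
        intro m
        induction m with
        | zero => simp [hf1]
        | succ m ih => rw [pow_succ, pow_succ, ih, hfmul]
      have : f (g ^ n) = 1 := by
        rw [← hf1]; simp only [hf, map_pow, hρ, map_one]
      simp [h1, this]
  have hcomm : Pairwise fun i j => Commute (f i) (f j) := by
    intro g h _
    change f g * f h = f h * f g
    rw [← hfmul, mul_comm, hfmul]
  have H := Module.End.iSup_iInf_maxGenEigenspace_eq_top_of_iSup_maxGenEigenspace_eq_top_of_commute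
    f hcomm htop
  set B : Set (Fin N → F) := {v | ∃ a : G → F, ∀ g, f g v = a g • v} with hB
  have hspan : ⊤ ≤ Submodule.span F B := by
    rw [← H]
    apply iSup_le
    intro a v hv
    apply Submodule.subset_span
    refine ⟨a, fun g => ?_⟩
    have := (Submodule.mem_iInf _).1 hv g
    rw [(hss g).isFinitelySemisimple.maxGenEigenspace_eq_eigenspace] at this
    exact Module.End.mem_eigenspace_iff.1 this
  let b0 := Module.Basis.ofSpan hspan
  have hfin := Module.Finite.finite_basis b0
  let _ := Fintype.ofFinite (↑((linearIndepOn_empty F id).extend (Set.empty_subset B)))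
  have hcard : Module.finrank F (Fin N → F) = N := by simp
  have hb0 : ∀ i, b0 i ∈ B := fun i => Module.Basis.ofSpan_subset hspan ⟨i, rfl⟩
  let e := Fintype.equivFinOfCardEq ((Module.finrank_eq_card_basis b0).symm.trans hcard)
  let b := b0.reindex e
  have hb : ∀ j, ∃ a : G → F, ∀ g, f g (b j) = a g • b j := by
    intro j
    have h := hb0 (e.symm j)
    have h2 : b j = b0 (e.symm j) := by simp [b]
    rw [h2]; exact h
  choose a ha using hb
  have hbne : ∀ j, b j ≠ 0 := fun j => b.ne_zero j
  have ha1 : ∀ j, a j 1 = 1 := by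
    intro j
    have h := ha j 1
    rw [hf1] at h
    have h2 : (1 : F) • b j = a j 1 • b j := by simpa using h
    exact (smul_left_injective F (hbne j) h2).symm
  have hamul : ∀ j g h, a j (g * h) = a j g * a j h := by
    intro j g h
    have h1 := ha j (g * h)
    rw [hfmul, Module.End.mul_apply, ha j h, map_smul, ha j g, smul_smul] at h1
    rw [mul_comm (a j g)]
    exact (smul_left_injective F (hbne j) h1).symm
  let χ : Fin N → G →* Fˣ := fun j =>
    MonoidHom.toHomUnits { toFun := a j, map_one' := ha1 j, map_mul' := hamul j }
  have hdet : IsUnit (Matrix.of (fun i j => b j i)) := by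
    have := (Pi.basisFun F (Fin N)).invertibleToMatrix b
    have h2 : (Pi.basisFun F (Fin N)).toMatrix b = Matrix.of (fun i j => b j i) := by
      ext i j; simp [Module.Basis.toMatrix_apply]
    rw [← h2]
    exact isUnit_of_invertible _
  refine ⟨hdet.unit, χ, fun g => ?_⟩
  ext i j
  have := congrFun (ha j g) i
  rw [Matrix.mul_diagonal]
  simp only [hf, Matrix.toLin'_apply, Matrix.mulVec, dotProduct, Pi.smul_apply, smul_eq_mul] at this
  simp only [IsUnit.unit_spec, Matrix.mul_apply, Matrix.of_apply, this]
  rw [mul_comm]; rfl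
lemma fAct_algebraMap (M : GL (Fin N) k) (p : MvPolynomial (Fin N) k) :
    fAct M (algebraMap (MvPolynomial (Fin N) k) (FractionRing (MvPolynomial (Fin N) k)) p) =
      algebraMap (MvPolynomial (Fin N) k) (FractionRing (MvPolynomial (Fin N) k)) (mAct (M : Matrix (Fin N) (Fin N) k) p) := by
  unfold fAct
  rw [IsFractionRing.ringEquivOfRingEquiv_algebraMap]
  rfl

lemma mAct_mAct (A B : Matrix (Fin N) (Fin N) k) (p : MvPolynomial (Fin N) k) :
    mAct A (mAct B p) = mAct (B * A) p := by
  rw [← mAct_comp]; rfl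

def orbPoly [Fintype G] (ρ : G → GL (Fin N) k) (i : Fin N) :
    Polynomial (MvPolynomial (Fin N) k) :=
  ∏ g, (Polynomial.X - Polynomial.C (mAct (ρ g : Matrix (Fin N) (Fin N) k) (X i)))

lemma orbPoly_inv [CommGroup G] [Fintype G] (ρ : G →* GL (Fin N) k) (i : Fin N) (n : ℕ) :
    IsInv (fun g => ρ g) (algebraMap (MvPolynomial (Fin N) k) (FractionRing (MvPolynomial (Fin N) k))
      ((orbPoly (fun g => ρ g) i).coeff n)) := by
  intro h
  rw [fAct_algebraMap]
  congr 1
  have : (orbPoly (fun g => ρ g) i).map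
      (mAct (ρ h : Matrix (Fin N) (Fin N) k)).toRingHom = orbPoly (fun g => ρ g) i := by
    unfold orbPoly
    rw [Polynomial.map_prod]
    simp only [Polynomial.map_sub, Polynomial.map_X, Polynomial.map_C]
    apply Fintype.prod_equiv (Equiv.mulRight h)
    intro g
    simp only [AlgHom.toRingHom_eq_coe, RingHom.coe_coe, mAct_mAct, Equiv.coe_mulRight, map_mul,
      Units.val_mul]
  conv_rhs => rw [← this]
  rw [Polynomial.coeff_map]
  rfl

lemma orbPoly_alg [CommGroup G] [Fintype G] (ρ : G →* GL (Fin N) k) (i : Fin N)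
    {L : Type} [Field L] [Algebra L (FractionRing (MvPolynomial (Fin N) k))]
    (h : ∀ n, algebraMap (MvPolynomial (Fin N) k) (FractionRing (MvPolynomial (Fin N) k))
      ((orbPoly (fun g => ρ g) i).coeff n) ∈
        Set.range (algebraMap L (FractionRing (MvPolynomial (Fin N) k)))) :
    IsAlgebraic L (algebraMap (MvPolynomial (Fin N) k) (FractionRing (MvPolynomial (Fin N) k)) (X i)) := by
  set Q := (orbPoly (fun g => ρ g) i).map
    (algebraMap (MvPolynomial (Fin N) k) (FractionRing (MvPolynomial (Fin N) k))) with hQ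
  have hmon : (orbPoly (fun g => ρ g) i).Monic := by
    unfold orbPoly
    exact Polynomial.monic_prod_of_monic _ _ fun g _ => Polynomial.monic_X_sub_C _
  have hQ0 : Q ≠ 0 := (hmon.map _).ne_zero
  have hl : Q ∈ Polynomial.lifts (algebraMap L (FractionRing (MvPolynomial (Fin N) k))) := by
    rw [Polynomial.lifts_iff_coeff_lifts]
    intro n
    rw [hQ, Polynomial.coeff_map]
    exact h n
  obtain ⟨q, hq⟩ := (Polynomial.mem_lifts _).1 hl
  refine ⟨q, ?_, ?_⟩
  · rintro rfl
    apply hQ0; rw [← hq]; simp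
  · rw [Polynomial.aeval_def, ← Polynomial.eval_map, hq, hQ, Polynomial.eval_map,
      Polynomial.eval₂_at_apply]
    have : Polynomial.eval (X i) (orbPoly (fun g => ρ g) i) = 0 := by
      unfold orbPoly
      rw [Polynomial.eval_prod]
      apply Finset.prod_eq_zero (Finset.mem_univ (1 : G))
      simp [mAct_one]
    rw [this, map_zero]

lemma all_alg (L : IntermediateField k (FractionRing (MvPolynomial (Fin N) k)))
    (h : ∀ i, IsAlgebraic L (algebraMap (MvPolynomial (Fin N) k) (FractionRing (MvPolynomial (Fin N) k)) (X i))) :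
    Algebra.IsAlgebraic L (FractionRing (MvPolynomial (Fin N) k)) := by
  have hp : ∀ p : MvPolynomial (Fin N) k,
      IsAlgebraic L (algebraMap (MvPolynomial (Fin N) k) (FractionRing (MvPolynomial (Fin N) k)) p) := by
    intro p
    induction p using MvPolynomial.induction_on with
    | C a =>
      have : algebraMap (MvPolynomial (Fin N) k) (FractionRing (MvPolynomial (Fin N) k)) (C a : MvPolynomial (Fin N) k) =
          algebraMap L _ (algebraMap k L a) := by
        rw [← IsScalarTower.algebraMap_apply k L, ← MvPolynomial.algebraMap_eq,
          ← IsScalarTower.algebraMap_apply]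
      rw [this]
      exact isAlgebraic_algebraMap _
    | add p q hp hq => rw [map_add]; exact hp.add hq
    | mul_X p i hp => rw [map_mul]; exact hp.mul (h i)
  refine ⟨fun x => ?_⟩
  obtain ⟨a, b, hb, rfl⟩ := IsFractionRing.div_surjective (A := MvPolynomial (Fin N) k) x
  rw [div_eq_mul_inv]
  exact (hp a).mul (hp b).inv

open scoped IntermediateField.algebraAdjoinAdjoin in
lemma mem_gset (ρ : G → GL (Fin N) k) (d : ℕ)
    (t : Set (FractionRing (MvPolynomial (Fin N) k))) (ht : ∀ f ∈ t, IsInv ρ f ∧ RDegLE f d)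
    (h : ∀ i, IsAlgebraic (IntermediateField.adjoin k t)
      (algebraMap (MvPolynomial (Fin N) k) (FractionRing (MvPolynomial (Fin N) k)) (X i))) :
    ∃ s : Set (FractionRing (MvPolynomial (Fin N) k)),
    (∀ f ∈ s, IsInv ρ f ∧ RDegLE f d) ∧
    AlgebraicIndependent k ((↑) : s → FractionRing (MvPolynomial (Fin N) k)) ∧
    ∀ f, IsInv ρ f → IsAlgebraic (IntermediateField.adjoin k s) f := by
  have h1 := all_alg _ h
  have h2 : Algebra.IsAlgebraic (Algebra.adjoin k t) (FractionRing (MvPolynomial (Fin N) k)) :=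
    (IsFractionRing.comap_isAlgebraic_iff (A := Algebra.adjoin k t)
      (K := IntermediateField.adjoin k t)).2 h1
  obtain ⟨u, hut, hu⟩ := exists_isTranscendenceBasis_subset (R := k) t
  refine ⟨u, fun f hf => ht f (hut hf), hu.1, fun f _ => ?_⟩
  have h3 := hu.isAlgebraic_field
  rw [Subtype.range_coe] at h3
  exact h3.isAlgebraic f

lemma RDegLE_poly (p : MvPolynomial (Fin N) k) (d : ℕ) (h : p.totalDegree ≤ d) :
    RDegLE (algebraMap (MvPolynomial (Fin N) k) (FractionRing (MvPolynomial (Fin N) k)) p) d :=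
  ⟨p, 1, one_ne_zero, fun q _ h => isUnit_of_dvd_one h, by simp, by simpa using h⟩

lemma gset_nonempty [CommGroup G] [Fintype G] (ρ : G →* GL (Fin N) k) :
    ∃ d, ∃ s : Set (FractionRing (MvPolynomial (Fin N) k)),
    (∀ f ∈ s, IsInv (fun g => ρ g) f ∧ RDegLE f d) ∧
    AlgebraicIndependent k ((↑) : s → FractionRing (MvPolynomial (Fin N) k)) ∧
    ∀ f, IsInv (fun g => ρ g) f → IsAlgebraic (IntermediateField.adjoin k s) f := by
  classical
  let d : ℕ := ∑ i : Fin N, ∑ n ∈ (orbPoly (fun g => ρ g) i).support,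
    ((orbPoly (fun g => ρ g) i).coeff n).totalDegree
  refine ⟨d, mem_gset _ d {f | ∃ i n, f = algebraMap (MvPolynomial (Fin N) k) (FractionRing (MvPolynomial (Fin N) k))
      ((orbPoly (fun g => ρ g) i).coeff n)} ?_ ?_⟩
  · rintro f ⟨i, n, rfl⟩
    refine ⟨orbPoly_inv ρ i n, RDegLE_poly _ _ ?_⟩
    by_cases hn : n ∈ (orbPoly (fun g => ρ g) i).support
    · calc _ ≤ ∑ n ∈ (orbPoly (fun g => ρ g) i).support,
            ((orbPoly (fun g => ρ g) i).coeff n).totalDegree :=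
          Finset.single_le_sum (f := fun n => ((orbPoly (fun g => ρ g) i).coeff n).totalDegree)
            (fun _ _ => Nat.zero_le _) hn
        _ ≤ d := Finset.single_le_sum (f := fun i => ∑ n ∈ (orbPoly (fun g => ρ g) i).support,
            ((orbPoly (fun g => ρ g) i).coeff n).totalDegree)
            (fun _ _ => Nat.zero_le _) (Finset.mem_univ i)
    · rw [Polynomial.notMem_support_iff.1 hn]; simp
  · intro i
    apply orbPoly_alg ρ i
    intro n
    exact ⟨⟨_, IntermediateField.subset_adjoin _ _ ⟨i, n, rfl⟩⟩, rfl⟩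

lemma alg_of_gset [CommGroup G] [Fintype G] (ρ : G →* GL (Fin N) k)
    (s : Set (FractionRing (MvPolynomial (Fin N) k)))
    (hs : ∀ f, IsInv (fun g => ρ g) f → IsAlgebraic (IntermediateField.adjoin k s) f) (i : Fin N) :
    IsAlgebraic (IntermediateField.adjoin k s)
      (algebraMap (MvPolynomial (Fin N) k) (FractionRing (MvPolynomial (Fin N) k)) (X i)) := by
  have : IsAlgebraic (algebraicClosure (IntermediateField.adjoin k s)
      (FractionRing (MvPolynomial (Fin N) k)))
      (algebraMap (MvPolynomial (Fin N) k) (FractionRing (MvPolynomial (Fin N) k)) (X i)) := by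
    apply orbPoly_alg ρ i
    intro n
    exact ⟨⟨_, (mem_algebraicClosure_iff).2 (hs _ (orbPoly_inv ρ i n))⟩, rfl⟩
  exact this.restrictScalars _

lemma mAct_totalDegree (M : Matrix (Fin N) (Fin N) k) (p : MvPolynomial (Fin N) k) :
    (mAct M p).totalDegree ≤ p.totalDegree := by
  classical
  have hlin : ∀ i, (∑ j, C (M i j) * X j : MvPolynomial (Fin N) k).totalDegree ≤ 1 := by
    intro i
    apply totalDegree_finsetSum_le
    intro j _
    refine (totalDegree_mul _ _).trans ?_
    simp
  unfold mAct
  rw [aeval_def, eval₂_eq]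
  apply totalDegree_finsetSum_le
  intro m hm
  refine (totalDegree_mul _ _).trans ?_
  rw [MvPolynomial.algebraMap_eq, totalDegree_C, zero_add]
  refine (totalDegree_finsetProd _ _).trans ?_
  refine le_trans ?_ (le_totalDegree hm)
  apply Finset.sum_le_sum
  intro j _
  refine (totalDegree_pow _ _).trans ?_
  calc _ ≤ m j * 1 := Nat.mul_le_mul_left _ (hlin j)
    _ = _ := mul_one _

lemma invol_mem [CommGroup G] (ρ : G →* GL (Fin N) k) (h2 : (2 : k) ≠ 0)
    (hρ : ∀ g, ρ g ^ 2 = 1) :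
    ∃ s : Set (FractionRing (MvPolynomial (Fin N) k)),
    (∀ f ∈ s, IsInv (fun g => ρ g) f ∧ RDegLE f 2) ∧
    AlgebraicIndependent k ((↑) : s → FractionRing (MvPolynomial (Fin N) k)) ∧
    ∀ f, IsInv (fun g => ρ g) f → IsAlgebraic (IntermediateField.adjoin k s) f := by
  have htop : ∀ g, ⨆ μ : k, Module.End.maxGenEigenspace
      (Matrix.toLin' (ρ g : Matrix (Fin N) (Fin N) k)) μ = ⊤ := by
    intro g
    rw [eq_top_iff]
    intro v _
    set M := (ρ g : Matrix (Fin N) (Fin N) k) with hM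
    have hMM : M * M = 1 := by
      have := congrArg (fun u : GL (Fin N) k => (u : Matrix (Fin N) (Fin N) k)) (hρ g)
      simpa [pow_two] using this
    have hMv : M.mulVec (M.mulVec v) = v := by rw [Matrix.mulVec_mulVec, hMM, Matrix.one_mulVec]
    have e : v = (2 : k)⁻¹ • (v + M.mulVec v) + (2 : k)⁻¹ • (v - M.mulVec v) := by
      rw [← smul_add, add_add_sub_cancel, ← two_smul k v, smul_smul, inv_mul_cancel₀ h2, one_smul]
    rw [e]
    apply Submodule.add_mem
    · apply Submodule.smul_mem
      apply Submodule.mem_iSup_of_mem (1 : k)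
      apply Module.End.mem_maxGenEigenspace _ _ _ |>.2
      refine ⟨1, ?_⟩
      simp [Matrix.mulVec_add, hMv, add_comm]
    · apply Submodule.smul_mem
      apply Submodule.mem_iSup_of_mem (-1 : k)
      apply Module.End.mem_maxGenEigenspace _ _ _ |>.2
      refine ⟨1, ?_⟩
      simp [Matrix.mulVec_sub, hMv]
  obtain ⟨S, χ, hS⟩ := diag_aux ρ 2 (by exact_mod_cast h2) hρ htop
  let T : Matrix (Fin N) (Fin N) k := ((S⁻¹ : GL (Fin N) k) : Matrix (Fin N) (Fin N) k)
  have hTS : T * S = 1 := Units.inv_mul S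
  have hST : (S : Matrix (Fin N) (Fin N) k) * T = 1 := Units.mul_inv S
  have hTρ : ∀ g, T * ρ g = Matrix.diagonal (fun j => (χ j g : k)) * T := by
    intro g
    calc T * (ρ g : Matrix (Fin N) (Fin N) k) = T * (ρ g * (S : Matrix (Fin N) (Fin N) k)) * T := by
          rw [mul_assoc, mul_assoc, hST, mul_one]
      _ = _ := by rw [hS, ← mul_assoc, hTS, one_mul]
  have hy : ∀ g j, mAct (ρ g : Matrix (Fin N) (Fin N) k) (mAct T (X j)) =
      C (χ j g : k) * mAct T (X j) := by
    intro g j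
    rw [mAct_mAct, hTρ]
    simp [mAct, Matrix.diagonal_mul, Finset.mul_sum, mul_assoc]
  have hχ : ∀ g j, (χ j g : k) ^ 2 = 1 := by
    intro g j
    have h1 := hS (g ^ 2)
    rw [map_pow, hρ] at h1
    simp only [Units.val_one, one_mul] at h1
    have h3 : (1 : Matrix (Fin N) (Fin N) k) = Matrix.diagonal (fun j => (χ j (g ^ 2) : k)) := by
      calc (1 : Matrix (Fin N) (Fin N) k) = T * S := hTS.symm
        _ = T * (S * Matrix.diagonal (fun j => (χ j (g ^ 2) : k))) := by rw [← h1]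
        _ = _ := by rw [← mul_assoc, hTS, one_mul]
    have := congrFun (congrFun h3 j) j
    simp at this
    exact this.symm
  refine mem_gset _ 2 {f | ∃ j, f = algebraMap (MvPolynomial (Fin N) k) (FractionRing (MvPolynomial (Fin N) k))
      (mAct T (X j) ^ 2)} ?_ ?_
  · rintro f ⟨j, rfl⟩
    refine ⟨fun g => ?_, RDegLE_poly _ _ ?_⟩
    · rw [fAct_algebraMap, map_pow, hy, mul_pow, ← C_pow, hχ, C_1, one_mul]
    · refine (totalDegree_pow _ _).trans ?_
      have := mAct_totalDegree T (X j)
      rw [totalDegree_X] at this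
      omega
  · intro i
    have hyalg : ∀ j, IsAlgebraic (IntermediateField.adjoin k
        {f | ∃ j, f = algebraMap (MvPolynomial (Fin N) k) (FractionRing (MvPolynomial (Fin N) k)) (mAct T (X j) ^ 2)})
        (algebraMap (MvPolynomial (Fin N) k) (FractionRing (MvPolynomial (Fin N) k)) (mAct T (X j))) := by
      intro j
      apply IsAlgebraic.of_pow (n := 2) two_pos
      rw [← map_pow]
      exact isAlgebraic_algebraMap (R := IntermediateField.adjoin k
        {f | ∃ j, f = algebraMap (MvPolynomial (Fin N) k) (FractionRing (MvPolynomial (Fin N) k)) (mAct T (X j) ^ 2)})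
        ⟨_, IntermediateField.subset_adjoin _ _ ⟨j, rfl⟩⟩
    have hx : (X i : MvPolynomial (Fin N) k) = ∑ j, C ((S : Matrix (Fin N) (Fin N) k) i j) * mAct T (X j) := by
      have : mAct T (mAct (S : Matrix (Fin N) (Fin N) k) (X i)) = X i := by
        rw [mAct_mAct, hST, mAct_one]; rfl
      conv_lhs => rw [← this]
      conv_lhs => enter [2]; simp only [mAct, aeval_X]
      simp [map_sum, map_mul]
    rw [hx, map_sum]
    refine Finset.sum_induction _ (fun x => IsAlgebraic _ x) (fun _ _ ha hb => ha.add hb) isAlgebraic_zero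
      fun j _ => ?_
    rw [map_mul]
    refine IsAlgebraic.mul ?_ (hyalg j)
    have : algebraMap (MvPolynomial (Fin N) k) (FractionRing (MvPolynomial (Fin N) k))
        (C ((S : Matrix (Fin N) (Fin N) k) i j) : MvPolynomial (Fin N) k) =
        algebraMap (IntermediateField.adjoin k
        {f | ∃ j, f = algebraMap (MvPolynomial (Fin N) k) (FractionRing (MvPolynomial (Fin N) k)) (mAct T (X j) ^ 2)}) _
          (algebraMap k _ ((S : Matrix (Fin N) (Fin N) k) i j)) := by
      rw [← IsScalarTower.algebraMap_apply k, ← MvPolynomial.algebraMap_eq,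
          ← IsScalarTower.algebraMap_apply]
    rw [this]
    exact isAlgebraic_algebraMap _

lemma semi_inv (ρ : G → GL (Fin N) k) (f₁ f₂ : MvPolynomial (Fin N) k) (h1 : f₁ ≠ 0) (h2 : f₂ ≠ 0)
    (hcop : ∀ p : MvPolynomial (Fin N) k, p ∣ f₁ → p ∣ f₂ → IsUnit p)
    (hinv : IsInv ρ (algebraMap (MvPolynomial (Fin N) k) (FractionRing (MvPolynomial (Fin N) k)) f₁ /
        algebraMap (MvPolynomial (Fin N) k) (FractionRing (MvPolynomial (Fin N) k)) f₂)) (g : G) :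
    ∃ c : k, mAct (ρ g : Matrix (Fin N) (Fin N) k) f₁ = C c * f₁ ∧
      mAct (ρ g : Matrix (Fin N) (Fin N) k) f₂ = C c * f₂ := by
  set A := mAct (ρ g : Matrix (Fin N) (Fin N) k) with hA
  have hAinj : Function.Injective A := (mEquiv (ρ g)).injective
  have hA1 : A f₁ ≠ 0 := fun h => h1 (hAinj (by rw [h, map_zero]))
  have hA2 : A f₂ ≠ 0 := fun h => h2 (hAinj (by rw [h, map_zero]))
  have hI := IsFractionRing.injective (MvPolynomial (Fin N) k) (FractionRing (MvPolynomial (Fin N) k))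
  have h := hinv g
  rw [map_div₀, fAct_algebraMap, fAct_algebraMap, div_eq_div_iff, ← map_mul, ← map_mul] at h
  rotate_left
  · exact fun h => hA2 (hI (by rw [map_zero]; exact h))
  · exact fun h => h2 (hI (by rw [map_zero]; exact h))
  have h : A f₁ * f₂ = f₁ * A f₂ := hI h
  have hrel : IsRelPrime f₁ f₂ := fun p hp hq => hcop p hp hq
  have hdvd : f₁ ∣ A f₁ := hrel.dvd_of_dvd_mul_right (Dvd.intro _ h.symm)
  obtain ⟨q, hq⟩ := hdvd
  have hq0 : q ≠ 0 := by rintro rfl; exact hA1 (by rw [hq, mul_zero])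
  have hdeg : q.totalDegree = 0 := by
    have := mAct_totalDegree (ρ g : Matrix (Fin N) (Fin N) k) f₁
    rw [← hA, hq, totalDegree_mul_of_isDomain h1 hq0] at this
    omega
  rw [totalDegree_eq_zero_iff_eq_C] at hdeg
  refine ⟨coeff 0 q, ?_, ?_⟩
  · rw [← hdeg, hq, mul_comm]
  · rw [← hdeg]
    rw [hq, mul_assoc] at h
    exact (mul_left_cancel₀ h1 h).symm

lemma coeff_diag (a : Fin N → k) (F : MvPolynomial (Fin N) k) (m : Fin N →₀ ℕ) :
    coeff m (mAct (Matrix.diagonal a) F) = (∏ j, a j ^ m j) * coeff m F := by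
  classical
  induction F using MvPolynomial.induction_on' with
  | monomial u c =>
    have : mAct (Matrix.diagonal a) (monomial u c) = monomial u ((∏ j, a j ^ u j) * c) := by
      unfold mAct
      rw [aeval_monomial, Finsupp.prod_fintype _ _ (by simp)]
      have h1 : ∀ i, ∑ j, C (Matrix.diagonal a i j) * X j = (C (a i) * X i : MvPolynomial (Fin N) k) := by
        intro i
        rw [Finset.sum_eq_single i]
        · simp
        · intro j _ hj; simp [Matrix.diagonal_apply_ne' _ hj]
        · simp
      simp only [h1, mul_pow, Finset.prod_mul_distrib]
      rw [monomial_eq, Finsupp.prod_fintype _ _ (by simp)]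
      simp only [C_mul, map_prod, C_pow, MvPolynomial.algebraMap_eq]
      ring
    rw [this, coeff_monomial, coeff_monomial]
    split_ifs with h
    · rw [h]
    · simp
  | add p q hp hq => rw [map_add, coeff_add, hp, hq, coeff_add, mul_add]

lemma comb_aux {M : Type} [CommGroup M] (χ : Fin N → M) (ω : M → ℤ) (d : ℕ) (hd : d ≤ 2)
    (h1 : ω 1 = 0) (h2 : d = 2 → ∀ ψ, ω ψ⁻¹ = - ω ψ) (m m' : Fin N →₀ ℕ)
    (hm : m.degree + m'.degree ≤ d) (h : ∏ j, χ j ^ m j = ∏ j, χ j ^ m' j) :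
    ∑ j, ω (χ j) * m j = ∑ j, ω (χ j) * m' j := by
  classical
  let P : (Fin N →₀ ℕ) → M := fun m => ∏ j, χ j ^ m j
  let W : (Fin N →₀ ℕ) → ℤ := fun m => ∑ j, ω (χ j) * m j
  have P0 : P 0 = 1 := by simp [P]
  have W0 : W 0 = 0 := by simp [W]
  have PA : ∀ i m, P (Finsupp.single i 1 + m) = χ i * P m := by
    intro i m
    simp only [P, Finsupp.add_apply, pow_add, Finset.prod_mul_distrib]
    congr 1
    rw [Finset.prod_eq_single i]
    · simp
    · intro j _ hj; simp [hj.symm]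
    · simp
  have WA : ∀ i m, W (Finsupp.single i 1 + m) = ω (χ i) + W m := by
    intro i m
    simp only [W, Finsupp.add_apply, Nat.cast_add, mul_add, Finset.sum_add_distrib]
    congr 1
    rw [Finset.sum_eq_single i]
    · simp
    · intro j _ hj; simp [hj.symm]
    · simp
  have dec : ∀ m : Fin N →₀ ℕ, m = 0 ∨ ∃ i u, m = Finsupp.single i 1 + u ∧ m.degree = 1 + u.degree := by
    intro m
    by_cases h0 : m = 0
    · exact Or.inl h0
    · right
      obtain ⟨i, hi⟩ := Finsupp.ne_iff.1 h0
      have hle : Finsupp.single i 1 ≤ m := by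
        rw [Finsupp.single_le_iff]
        simp at hi; omega
      refine ⟨i, m - Finsupp.single i 1, (add_tsub_cancel_of_le hle).symm, ?_⟩
      conv_lhs => rw [← add_tsub_cancel_of_le hle, map_add, Finsupp.degree_single]
  have key : ∀ m m' : Fin N →₀ ℕ, m'.degree ≤ m.degree → m.degree + m'.degree ≤ d → P m = P m' → W m = W m' := by
    intro m m' hle hdeg hP
    rcases dec m with rfl | ⟨i, u, rfl, hu⟩
    · rcases dec m' with rfl | ⟨i', u', rfl, hu'⟩
      · rfl
      · simp only [map_zero] at hle; omega
    · rcases dec u with rfl | ⟨i2, u2, rfl, hu2⟩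
      · rcases dec m' with rfl | ⟨i', u', rfl, hu'⟩
        · rw [PA, P0, mul_one] at hP
          rw [WA, W0, hP, h1, add_zero]
        · rcases dec u' with rfl | ⟨i2, u2, rfl, hu2⟩
          · rw [PA, PA, P0, mul_one, mul_one] at hP
            rw [WA, WA, hP]
          · simp only [map_zero] at hu; omega
      · rcases dec u2 with rfl | ⟨i3, u3, rfl, hu3⟩
        · rcases dec m' with rfl | ⟨i', u', rfl, hu'⟩
          · simp only [map_zero] at hu2 hdeg
            rw [PA, PA, P0, mul_one] at hP
            have : χ i2 = (χ i)⁻¹ := (inv_eq_of_mul_eq_one_right hP).symm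
            rw [WA, WA, W0, this, h2 (by omega)]; ring
          · omega
        · omega
  rcases le_total m'.degree m.degree with hle | hle
  · exact key m m' hle hm h
  · exact (key m' m hle (by omega) h.symm).symm

section floor
variable {K : Type} [Field K] [Algebra k K]

def psi (k : Type) [Field k] {K : Type} [Field K] [Algebra k K] (M : GL (Fin N) K) :
    MvPolynomial (Fin N) k →+* MvPolynomial (Fin N) K :=
  (mAct (M : Matrix (Fin N) (Fin N) K)).toRingHom.comp (MvPolynomial.map (algebraMap k K))

lemma psi_apply (M : GL (Fin N) K) (p : MvPolynomial (Fin N) k) :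
    psi k M p = mAct (M : Matrix (Fin N) (Fin N) K) (MvPolynomial.map (algebraMap k K) p) := rfl

lemma psi_inj (M : GL (Fin N) K) : Function.Injective (psi k M) :=
  (mEquiv M).injective.comp (MvPolynomial.map_injective _ (algebraMap k K).injective)

def Phi (k : Type) [Field k] {K : Type} [Field K] [Algebra k K] (M : GL (Fin N) K) :
    FractionRing (MvPolynomial (Fin N) k) →+* FractionRing (MvPolynomial (Fin N) K) :=
  IsFractionRing.lift (A := MvPolynomial (Fin N) k)
    (g := (algebraMap (MvPolynomial (Fin N) K) (FractionRing (MvPolynomial (Fin N) K))).comp (psi k M))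
    ((IsFractionRing.injective _ _).comp (psi_inj M))

lemma Phi_alg (M : GL (Fin N) K) (p : MvPolynomial (Fin N) k) :
    Phi k M (algebraMap _ _ p) =
      algebraMap (MvPolynomial (Fin N) K) (FractionRing (MvPolynomial (Fin N) K)) (psi k M p) := by
  unfold Phi
  rw [IsFractionRing.lift_algebraMap]; rfl

def Dt (w : Fin N → ℤ) (t : Kˣ) : GL (Fin N) K :=
  Units.map (Matrix.diagonalRingHom (Fin N) K).toMonoidHom (MulEquiv.piUnits.symm fun j => t ^ w j)

lemma Dt_coe (w : Fin N → ℤ) (t : Kˣ) : (Dt w t : Matrix (Fin N) (Fin N) K) =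
    Matrix.diagonal fun j => ((t ^ w j : Kˣ) : K) := rfl

lemma map_mAct (M : Matrix (Fin N) (Fin N) k) (p : MvPolynomial (Fin N) k) :
    MvPolynomial.map (algebraMap k K) (mAct M p) =
      mAct (M.map (algebraMap k K)) (MvPolynomial.map (algebraMap k K) p) := by
  induction p using MvPolynomial.induction_on with
  | C a => simp [mAct]
  | add p q hp hq => simp only [map_add, hp, hq]
  | mul_X p i hp =>
    simp only [map_mul, hp, map_X]
    congr 1
    simp [mAct]

lemma psi_degree (M : GL (Fin N) K) (p : MvPolynomial (Fin N) k) :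
    (psi k M p).totalDegree ≤ p.totalDegree := by
  rw [psi_apply]
  refine (mAct_totalDegree _ _).trans ?_
  exact Finset.sup_mono (support_map_subset _ _)

lemma psi_semi {M : Matrix (Fin N) (Fin N) k} {S : GL (Fin N) K} {a : Fin N → K}
    (hS : M.map (algebraMap k K) * S = S * Matrix.diagonal a) (p : MvPolynomial (Fin N) k) (c : k)
    (hp : mAct M p = C c * p) (m : Fin N →₀ ℕ) (hm : coeff m (psi k S p) ≠ 0) :
    ∏ j, a j ^ m j = algebraMap k K c := by
  have : mAct (Matrix.diagonal a) (psi k S p) = C (algebraMap k K c) * psi k S p := by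
    rw [psi_apply, mAct_mAct, ← hS, ← mAct_mAct, ← map_mAct, hp, map_mul, map_mul, map_C]
    simp [mAct]
  have h := congrArg (coeff m) this
  rw [coeff_diag, coeff_C_mul] at h
  exact mul_right_cancel₀ hm h

lemma psi_weight (S : GL (Fin N) K) (w : Fin N → ℤ) (t : Kˣ) (p : MvPolynomial (Fin N) k) (e : ℤ)
    (h : ∀ m, coeff m (psi k S p) ≠ 0 → ∑ j, w j * m j = e) :
    psi k (S * Dt w t) p = C ((t ^ e : Kˣ) : K) * psi k S p := by
  ext m
  rw [psi_apply, Units.val_mul, ← mAct_mAct, ← psi_apply, Dt_coe, coeff_diag, coeff_C_mul]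
  by_cases hm : coeff m (psi k S p) = 0
  · rw [hm, mul_zero, mul_zero]
  · congr 1
    rw [← h m hm]
    have : ∏ j, (t ^ w j) ^ m j = t ^ (∑ j, w j * (m j : ℤ)) := by
      have h3 : ∀ s : Finset (Fin N), ∏ j ∈ s, (t ^ w j) ^ m j = t ^ (∑ j ∈ s, w j * (m j : ℤ)) := by
        classical
        intro s
        induction s using Finset.induction_on with
        | empty => simp
        | insert a s ha ih =>
          rw [Finset.prod_insert ha, Finset.sum_insert ha, ih, zpow_add, zpow_mul, zpow_natCast]
      exact h3 _
    rw [← this]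
    simp

lemma floor_aux [Infinite K] [CommGroup G] [Fintype G] (ρ : G →* GL (Fin N) k)
    (S : GL (Fin N) K) (χ : Fin N → G →* Kˣ)
    (hS : ∀ g, (ρ g : Matrix (Fin N) (Fin N) k).map (algebraMap k K) * S =
      S * Matrix.diagonal fun j => (χ j g : K))
    (ω : (G →* Kˣ) → ℤ) (d : ℕ) (hd : d ≤ 2)
    (h1 : ω 1 = 0) (h2 : d = 2 → ∀ ψ, ω ψ⁻¹ = - ω ψ) (j0 : Fin N) (hj0 : ω (χ j0) = 1)
    (s : Set (FractionRing (MvPolynomial (Fin N) k)))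
    (hs : ∀ f ∈ s, IsInv (fun g => ρ g) f ∧ RDegLE f d)
    (halg : ∀ f, IsInv (fun g => ρ g) f → IsAlgebraic (IntermediateField.adjoin k s) f) : False := by
  classical
  set w : Fin N → ℤ := fun j => ω (χ j) with hw
  set E := FractionRing (MvPolynomial (Fin N) K) with hE
  have hIK := IsFractionRing.injective (MvPolynomial (Fin N) K) E
  have hconst : ∀ (M : GL (Fin N) K) (c : k),
      Phi k M (algebraMap k _ c) = algebraMap (MvPolynomial (Fin N) K) E (C (algebraMap k K c)) := by
    intro M c
    rw [IsScalarTower.algebraMap_apply k (MvPolynomial (Fin N) k), Phi_alg]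
    congr 1
    simp [psi_apply, mAct]
  have hgen : ∀ f ∈ s, ∀ t : Kˣ, Phi k (S * Dt w t) f = Phi k S f := by
    intro f hf t
    obtain ⟨hinv, f₁, f₂, hf2, hcop, rfl, hdeg⟩ := hs f hf
    by_cases hf1 : f₁ = 0
    · simp [hf1]
    have hsemi := semi_inv (fun g => ρ g) f₁ f₂ hf1 hf2 hcop hinv
    choose c hc1 hc2 using hsemi
    set P₁ := psi k S f₁ with hP1
    set P₂ := psi k S f₂ with hP2
    have hP10 : P₁ ≠ 0 := fun h => hf1 (psi_inj S (by rw [map_zero]; exact h))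
    have hP20 : P₂ ≠ 0 := fun h => hf2 (psi_inj S (by rw [map_zero]; exact h))
    have hcomb : ∀ m m', coeff m P₁ ≠ 0 → coeff m' P₂ ≠ 0 →
        ∑ j, w j * (m j : ℤ) = ∑ j, w j * (m' j : ℤ) := by
      intro m m' hm hm'
      apply comb_aux χ ω d hd h1 h2 m m'
      · have e1 : m.degree ≤ P₁.totalDegree := le_totalDegree (mem_support_iff.2 hm)
        have e2 : m'.degree ≤ P₂.totalDegree := le_totalDegree (mem_support_iff.2 hm')
        have e3 : P₁.totalDegree ≤ _ := psi_degree S f₁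
        have e4 : P₂.totalDegree ≤ _ := psi_degree S f₂
        omega
      · ext g
        have e1 := psi_semi (hS g) f₁ (c g) (hc1 g) m hm
        have e2 := psi_semi (hS g) f₂ (c g) (hc2 g) m' hm'
        have := e1.trans e2.symm
        simpa [MonoidHom.finsetProd_apply] using this
    obtain ⟨m1, hm1⟩ := MvPolynomial.ne_zero_iff.1 hP10
    obtain ⟨m2, hm2⟩ := MvPolynomial.ne_zero_iff.1 hP20
    have e1 := psi_weight S w t f₁ (∑ j, w j * (m2 j : ℤ)) (fun m hm => hcomb m m2 hm hm2)
    have e2 := psi_weight S w t f₂ (∑ j, w j * (m2 j : ℤ))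
      (fun m hm => (hcomb m1 m hm1 hm).symm.trans (hcomb m1 m2 hm1 hm2))
    rw [map_div₀, map_div₀, Phi_alg, Phi_alg, Phi_alg, Phi_alg, e1, e2, map_mul, map_mul]
    apply mul_div_mul_left
    intro h0
    have : (C (((t ^ (∑ j, w j * (m2 j : ℤ)) : Kˣ)) : K) : MvPolynomial (Fin N) K) = 0 :=
      hIK (by rw [map_zero]; exact h0)
    rw [MvPolynomial.C_eq_zero] at this
    exact Units.ne_zero _ this
  have hL : ∀ t : Kˣ, ∀ x ∈ IntermediateField.adjoin k s,
      Phi k (S * Dt w t) x = Phi k S x := by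
    intro t x hx
    induction hx using IntermediateField.adjoin_induction with
    | mem x hx => exact hgen x hx t
    | algebraMap c => rw [hconst, hconst]
    | add x y _ _ hx hy => rw [map_add, map_add, hx, hy]
    | mul x y _ _ hx hy => rw [map_mul, map_mul, hx, hy]
    | inv x _ hx => rw [map_inv₀, map_inv₀, hx]
  -- pick a row
  obtain ⟨i, hi⟩ : ∃ i, (S : Matrix (Fin N) (Fin N) K) i j0 ≠ 0 := by
    by_contra hcon
    push Not at hcon
    have : ((S⁻¹ : GL (Fin N) K) : Matrix (Fin N) (Fin N) K) * (S : Matrix (Fin N) (Fin N) K) = 1 :=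
      Units.inv_mul S
    have := congrFun (congrFun this j0) j0
    simp [Matrix.mul_apply, hcon] at this
  obtain ⟨q, hq0, hq⟩ := alg_of_gset ρ s halg i
  set Q : Polynomial E := q.map ((Phi k S).comp
    (algebraMap (IntermediateField.adjoin k s) (FractionRing (MvPolynomial (Fin N) k)))) with hQ
  have hQ0 : Q ≠ 0 := by
    rw [hQ]
    exact (Polynomial.map_ne_zero_iff (RingHom.injective _)).2 hq0
  have hroot : ∀ t : Kˣ, Phi k (S * Dt w t) (algebraMap (MvPolynomial (Fin N) k) (FractionRing (MvPolynomial (Fin N) k)) (X i)) ∈ Q.rootSet E := by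
    intro t
    rw [Polynomial.mem_rootSet]
    refine ⟨hQ0, ?_⟩
    have h3 : (Phi k S).comp
        (algebraMap (IntermediateField.adjoin k s) (FractionRing (MvPolynomial (Fin N) k))) =
        (Phi k (S * Dt w t)).comp
        (algebraMap (IntermediateField.adjoin k s) (FractionRing (MvPolynomial (Fin N) k))) := by
      ext x
      exact (hL t x.1 x.2).symm
    rw [hQ, h3, Polynomial.aeval_def, Polynomial.eval₂_map]
    rw [Polynomial.aeval_def] at hq
    have := congrArg (Phi k (S * Dt w t)) hq
    rw [Polynomial.hom_eval₂, map_zero] at this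
    exact this
  have hinj : Function.Injective fun t : Kˣ =>
      Phi k (S * Dt w t) (algebraMap (MvPolynomial (Fin N) k) _ (X i)) := by
    intro t t' h
    simp only [Phi_alg] at h
    have h := congrArg (coeff (Finsupp.single j0 1)) (hIK h)
    have hc : ∀ M : GL (Fin N) K, coeff (Finsupp.single j0 1) (psi k M (X i)) =
        (M : Matrix (Fin N) (Fin N) K) i j0 := by
      intro M
      simp [psi_apply, mAct, coeff_sum, coeff_C_mul, coeff_X, Finsupp.single_left_inj]
    rw [hc, hc, Units.val_mul, Units.val_mul, Dt_coe, Dt_coe, Matrix.mul_diagonal,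
      Matrix.mul_diagonal] at h
    have h := mul_left_cancel₀ hi h
    rw [Units.val_inj] at h
    simpa [hw, hj0] using h
  have : Infinite Kˣ := by
    rw [(unitsEquivNeZero (G₀ := K)).infinite_iff]
    exact (Set.finite_singleton (0 : K)).infinite_compl.to_subtype
  exact Set.infinite_of_injective_forall_mem hinj hroot (Q.rootSet_finite E)

end floor
lemma chi_inv_inv {G K : Type} [CommGroup G] [Field K] (a : G →* Kˣ) : a⁻¹⁻¹ = a := by
  apply MonoidHom.ext
  intro g
  rw [MonoidHom.inv_apply, MonoidHom.inv_apply, inv_inv]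

lemma chi_sq {G K : Type} [CommGroup G] [Field K] (a : G →* Kˣ) (h : a = a⁻¹) : a ^ 2 = 1 := by
  apply MonoidHom.ext
  intro g
  have h1 : a g = (a g)⁻¹ := by
    conv_lhs => rw [h]
    rw [MonoidHom.inv_apply]
  rw [MonoidHom.pow_apply, MonoidHom.one_apply, pow_two]
  exact mul_eq_one_iff_eq_inv.2 h1

lemma chi_one_sq {G K : Type} [CommGroup G] [Field K] : (1 : G →* Kˣ) ^ 2 = 1 := by
  apply MonoidHom.ext
  intro g
  rw [MonoidHom.pow_apply, MonoidHom.one_apply, one_pow]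

lemma chi_one_inv {G K : Type} [CommGroup G] [Field K] (a : G →* Kˣ) (h : 1 = a⁻¹) : a = 1 := by
  apply MonoidHom.ext
  intro g
  have h1 := DFunLike.congr_fun h g
  rw [MonoidHom.inv_apply, MonoidHom.one_apply] at h1
  rw [MonoidHom.one_apply]
  exact inv_eq_one.1 h1.symm

lemma main_aux {k : Type} [Field k] {N : ℕ} {G : Type} [CommGroup G] [Fintype G]
    (K : Type) [Field K] [Algebra k K] [IsAlgClosed K]
    (hchar : (Fintype.card G : k) ≠ 0) (ρ : G →* GL (Fin N) k)
    (hnontriv : ∃ g, ρ g ≠ 1) :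
    (gammaR (fun g => ρ g) = 2 ↔
      ∀ χ : G →* Kˣ, χ ≠ 1 → Occurs (fun g => ρ g) χ → χ ^ 2 = 1) ∧
    ((∃ χ : G →* Kˣ, χ ≠ 1 ∧ Occurs (fun g => ρ g) χ ∧ χ ^ 2 ≠ 1) →
      3 ≤ gammaR (fun g => ρ g)) := by
  classical
  let ρK : G →* GL (Fin N) K := (Matrix.GeneralLinearGroup.map (algebraMap k K)).comp ρ
  have hρK : ∀ g, (ρK g : Matrix (Fin N) (Fin N) K) =
      (ρ g : Matrix (Fin N) (Fin N) k).map (algebraMap k K) := fun g => rfl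
  obtain ⟨S, χ, hS⟩ := diag_aux ρK (Fintype.card G)
    (by
      rw [← map_natCast (algebraMap k K)]
      exact fun h => hchar ((algebraMap k K).injective (by rw [h, map_zero])))
    (fun g => by rw [← map_pow, pow_card_eq_one, map_one])
    (fun g => Module.End.iSup_maxGenEigenspace_eq_top _)
  simp only [hρK] at hS
  let T : Matrix (Fin N) (Fin N) K := ((S⁻¹ : GL (Fin N) K) : Matrix (Fin N) (Fin N) K)
  have hTS : T * S = 1 := Units.inv_mul S
  have hST : (S : Matrix (Fin N) (Fin N) K) * T = 1 := Units.mul_inv S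
  have hinf : Infinite K := IsAlgClosed.instInfinite
  have hA : ∀ χ0 : G →* Kˣ, Occurs (fun g => ρ g) χ0 → ∃ j, χ j = χ0 := by
    rintro χ0 ⟨v, hv, hv2⟩
    have hu : T.mulVec v ≠ 0 := by
      intro h0
      apply hv
      rw [← Matrix.one_mulVec v, ← hST, ← Matrix.mulVec_mulVec, h0, Matrix.mulVec_zero]
    obtain ⟨j, hj⟩ := Function.ne_iff.1 hu
    refine ⟨j, ?_⟩
    ext g
    have h1 : (Matrix.diagonal fun j => (χ j g : K)).mulVec (T.mulVec v) =
        (χ0 g : K) • T.mulVec v := by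
      rw [← Matrix.mulVec_smul, ← hv2 g, Matrix.mulVec_mulVec, Matrix.mulVec_mulVec]
      congr 1
      calc _ = T * (S * Matrix.diagonal fun j => (χ j g : K)) * T := by
            rw [← mul_assoc T, hTS, one_mul]
        _ = _ := by rw [← hS, mul_assoc, mul_assoc, hST, mul_one]
    have h2 := congrFun h1 j
    rw [Matrix.mulVec_diagonal] at h2
    exact mul_right_cancel₀ hj h2
  have hB : ∀ j, Occurs (fun g => ρ g) (χ j) := by
    intro j
    refine ⟨(S : Matrix (Fin N) (Fin N) K).mulVec (Pi.single j 1), ?_, fun g => ?_⟩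
    · intro h0
      have h1 : T.mulVec ((S : Matrix (Fin N) (Fin N) K).mulVec (Pi.single j 1)) = 0 := by
        rw [h0, Matrix.mulVec_zero]
      rw [Matrix.mulVec_mulVec, hTS, Matrix.one_mulVec] at h1
      have := congrFun h1 j
      simp at this
    · rw [Matrix.mulVec_mulVec, hS, ← Matrix.mulVec_mulVec, ← Matrix.mulVec_smul]
      congr 1
      ext i
      rw [Matrix.mulVec_diagonal]
      by_cases hij : i = j
      · subst hij; simp
      · simp [hij]
  have hmapinj : ∀ A : Matrix (Fin N) (Fin N) k, A.map (algebraMap k K) = 1 → A = 1 := by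
    intro A h
    apply Matrix.map_injective (algebraMap k K).injective
    change A.map (algebraMap k K) = (1 : Matrix (Fin N) (Fin N) k).map (algebraMap k K)
    rw [h, Matrix.map_one _ (map_zero _) (map_one _)]
  have hρ1 : ∀ g, (∀ j, χ j g = 1) → ρ g = 1 := by
    intro g hg
    apply Units.ext
    apply hmapinj
    have h1 := hS g
    simp only [hg, Units.val_one, Matrix.diagonal_one, mul_one] at h1
    calc _ = ((ρ g : Matrix (Fin N) (Fin N) k).map (algebraMap k K)) * S * T := by
          rw [mul_assoc, hST, mul_one]
      _ = 1 := by rw [h1, hST]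
  obtain ⟨j1, hj1⟩ : ∃ j, χ j ≠ 1 := by
    by_contra hcon
    push Not at hcon
    obtain ⟨g, hg⟩ := hnontriv
    exact hg (hρ1 g fun j => by rw [hcon]; rfl)
  have hlow : ∀ d ≤ 1, d ∉ {d : ℕ | ∃ s : Set (FractionRing (MvPolynomial (Fin N) k)),
      (∀ f ∈ s, IsInv (fun g => ρ g) f ∧ RDegLE f d) ∧
      AlgebraicIndependent k ((↑) : s → FractionRing (MvPolynomial (Fin N) k)) ∧
      ∀ f, IsInv (fun g => ρ g) f → IsAlgebraic (IntermediateField.adjoin k s) f} := by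
    rintro d hd ⟨s, hs1, -, hs2⟩
    exact floor_aux ρ S χ hS (fun ψ => if ψ = χ j1 then 1 else 0) d (by omega)
      (by simp [Ne.symm hj1]) (fun h => by omega) j1 (by simp) s hs1 hs2
  have hmem := Nat.sInf_mem (gset_nonempty ρ)
  change gammaR (fun g => ρ g) ∈ _ at hmem
  have hge2 : 2 ≤ gammaR (fun g => ρ g) := by
    by_contra hcon
    exact hlow _ (by omega) hmem
  have hthree : (∃ χ : G →* Kˣ, χ ≠ 1 ∧ Occurs (fun g => ρ g) χ ∧ χ ^ 2 ≠ 1) →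
      3 ≤ gammaR (fun g => ρ g) := by
    rintro ⟨χ0, h1, hocc, h2⟩
    obtain ⟨j, rfl⟩ := hA χ0 hocc
    have hne : χ j ≠ (χ j)⁻¹ := fun h => h2 (chi_sq _ h)
    by_contra hcon
    have heq : gammaR (fun g => ρ g) = 2 := by omega
    rw [heq] at hmem
    obtain ⟨s, hs1, -, hs2⟩ := hmem
    refine floor_aux ρ S χ hS (fun ψ => if ψ = χ j then 1 else if ψ = (χ j)⁻¹ then -1 else 0) 2
      le_rfl ?_ (fun _ ψ => ?_) j (by simp) s hs1 hs2
    · have : (1 : G →* Kˣ) ≠ (χ j)⁻¹ := fun h => h1 (chi_one_inv _ h)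
      simp [Ne.symm h1, this]
    · by_cases e1 : ψ = χ j
      · subst e1; simp [hne.symm]
      · by_cases e2 : ψ = (χ j)⁻¹
        · subst e2; simp [hne.symm, chi_inv_inv]
        · have e3 : ψ⁻¹ ≠ χ j := fun h => e2 (by rw [← h, chi_inv_inv])
          have e4 : ψ⁻¹ ≠ (χ j)⁻¹ := fun h => e1 (by rw [← chi_inv_inv ψ, h, chi_inv_inv])
          simp only [e1, e2, e3, e4, if_false, neg_zero]
  refine ⟨⟨fun heq χ0 h1 hocc => ?_, fun hall => ?_⟩, hthree⟩
  · by_contra h2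
    have := hthree ⟨χ0, h1, hocc, h2⟩
    omega
  · have hsq : ∀ j, χ j ^ 2 = 1 := by
      intro j
      by_cases h : χ j = 1
      · rw [h, chi_one_sq]
      · exact hall _ h (hB j)
    have hρ2 : ∀ g, ρ g ^ 2 = 1 := by
      intro g
      rw [← map_pow]
      apply hρ1
      intro j
      rw [map_pow]
      exact DFunLike.congr_fun (hsq j) g
    have h2 : (2 : k) ≠ 0 := by
      intro h0
      obtain ⟨g, hg⟩ := hnontriv
      have hord : orderOf (ρ g) = 2 := orderOf_eq_prime (hρ2 g) hg
      have hdvd : 2 ∣ Fintype.card G := by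
        rw [← hord]
        exact (orderOf_map_dvd ρ g).trans orderOf_dvd_card
      obtain ⟨c, hc⟩ := hdvd
      apply hchar
      rw [hc]; push_cast; rw [h0, zero_mul]
    exact le_antisymm (Nat.sInf_le (invol_mem ρ h2 hρ2)) hge2


/-- "Hard floor": for a nontrivial representation of a finite abelian group
in nonmodular characteristic, `γ^r(G,V) = 2` iff every nontrivial character occurring in the
base change of `V` to an algebraic closure is an involution; otherwise `γ^r(G,V) ≥ 3`. -/
theorem stmt13 {k : Type} [Field k] {N : ℕ} {G : Type} [CommGroup G] [Fintype G]
    (hchar : (Fintype.card G : k) ≠ 0) (ρ : G →* GL (Fin N) k)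
    (hnontriv : ∃ g, ρ g ≠ 1) :
    (gammaR (fun g => ρ g) = 2 ↔
      ∀ χ : G →* (AlgebraicClosure k)ˣ, χ ≠ 1 → Occurs (fun g => ρ g) χ → χ ^ 2 = 1) ∧
    ((∃ χ : G →* (AlgebraicClosure k)ˣ, χ ≠ 1 ∧ Occurs (fun g => ρ g) χ ∧ χ ^ 2 ≠ 1) →
      3 ≤ gammaR (fun g => ρ g)) := by
  exact main_aux (AlgebraicClosure k) hchar ρ hnontriv
end
end

section
/- Let n ≥ 3 be an integer, G = ℤ/nℤ, and 1 ≤ m < n. Define S_m ⊂ ℤ/nℤ as follows: if m is even, S_m = {±1, ±2, …, ±m/2}; if m is odd, S_m = {±1, ±2, …, ±(m−1)/2, (m+1)/2}. Let k be a field of characteristic coprime to n containing a primitive n-th root of unity ζ, and let V be the m-dimensional diagonal representation of G over k in which the generator of G acts on the i-th coordinate by ζ^{s_i}, where s₁,…,s_m enumerate S_m. Then β^r(G,V) = γ^r(G,V) = max(3, ⌈n/⌈m/2⌉⌉). -/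
open MvPolynomial

noncomputable section

variable {k : Type} [Field k] {N : ℕ} {G : Type}

variable [CommGroup G]

/-- The invertible diagonal matrix with units `c i` on the diagonal. -/
def diagGL (c : Fin N → kˣ) : GL (Fin N) k :=
  ⟨Matrix.diagonal fun i => (c i : k), Matrix.diagonal fun i => ((c i)⁻¹ : kˣ),
   by simp [Matrix.diagonal_mul_diagonal], by simp [Matrix.diagonal_mul_diagonal]⟩

/-- The diagonal linear action of `G` attached to a tuple of characters `χ i : G →* kˣ`:
`g` acts by scaling the `i`-th coordinate by `χ i g`. -/
def diagρ (χ : Fin N → (G →* kˣ)) : G → GL (Fin N) k :=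
  fun g => diagGL fun i => χ i g

/-- The exponent vector `a ∈ ℤᴺ` lies in the lattice `L(G,V)` of exponent vectors of
`G`-invariant Laurent monomials. -/
def inLat (χ : Fin N → (G →* kˣ)) (a : Fin N → ℤ) : Prop :=
  ∀ g, ∏ i, (χ i g) ^ (a i) = 1

/-- The degree (`L¹`-norm) of an exponent vector. -/
def degZ (a : Fin N → ℤ) : ℕ := ∑ i, (a i).natAbs

/-- The Laurent monomial `x^a ∈ k(x₁,…,x_N)` with exponent vector `a : Fin N → ℤ`. -/
def laur (a : Fin N → ℤ) : FractionRing (MvPolynomial (Fin N) k) :=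
  ∏ i, (algebraMap (MvPolynomial (Fin N) k) (FractionRing (MvPolynomial (Fin N) k)) (X i)) ^ (a i)

/-- The lattice `L(G,V)` as an additive subgroup of `ℤᴺ`. -/
def latgrp (χ : Fin N → (G →* kˣ)) : AddSubgroup (Fin N → ℤ) where
  carrier := {a | inLat χ a}
  zero_mem' := by intro g; simp
  add_mem' := by
    intro a b ha hb g
    simp only [Pi.add_apply, zpow_add]
    rw [Finset.prod_mul_distrib, ha g, hb g, mul_one]
  neg_mem' := by
    intro a ha g
    simp only [Pi.neg_apply, zpow_neg]
    rw [Finset.prod_inv_distrib, ha g, inv_one]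

/-- The set `S_m ⊆ ℤ` of characters: `{±1,…,±(m/2)}` for even `m`, and
`{±1,…,±((m−1)/2), (m+1)/2}` for odd `m`. -/
def Sset (m : ℕ) : Set ℤ :=
  if m % 2 = 0 then {a : ℤ | a ≠ 0 ∧ a.natAbs ≤ m / 2}
  else {a : ℤ | (a ≠ 0 ∧ a.natAbs ≤ (m - 1) / 2) ∨ a = ((m + 1) / 2 : ℕ)}


section helpers

local notation "PP" => MvPolynomial (Fin N) k
local notation "KK" => FractionRing (MvPolynomial (Fin N) k)

lemma fAct_algMap (M : GL (Fin N) k) (p : PP) :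
    fAct M (algebraMap PP KK p) = algebraMap PP KK (mEquiv M p) := by
  unfold fAct
  exact IsFractionRing.ringEquivOfRingEquiv_algebraMap _ _

lemma mEquiv_diag_X (χ : Fin N → (G →* kˣ)) (g : G) (i : Fin N) :
    mEquiv (diagρ χ g) (X i) = C (χ i g : k) * X i := by
  simp [mEquiv, mAct, diagρ, diagGL, Matrix.diagonal_apply, ite_mul, apply_ite C]

lemma mEquiv_diag_coeff (χ : Fin N → (G →* kˣ)) (g : G) (p : PP) (a : Fin N →₀ ℕ) :
    coeff a (mEquiv (diagρ χ g) p) = (∏ i, (χ i g : k) ^ a i) * coeff a p := by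
  induction p using MvPolynomial.induction_on' with
  | monomial u c =>
    have : mEquiv (diagρ χ g) (monomial u c) = C (∏ i, (χ i g : k) ^ u i) * monomial u c := by
      rw [monomial_eq, map_mul, Finsupp.prod_fintype _ _ (by simp), map_prod]
      simp only [map_pow, mEquiv_diag_X, mul_pow, Finset.prod_mul_distrib, map_prod]
      have : mEquiv (diagρ χ g) (C c) = C c := (mEquiv (diagρ χ g)).commutes c
      rw [this]; ring
    rw [this, coeff_C_mul, coeff_monomial]
    split_ifs with h
    · rw [h]
    · simp
  | add p q hp hq => simp [hp, hq, mul_add]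

lemma fAct_k (M : GL (Fin N) k) (c : k) : fAct M (algebraMap k KK c) = algebraMap k KK c := by
  rw [IsScalarTower.algebraMap_apply k PP KK, fAct_algMap, MvPolynomial.algebraMap_eq]
  congr 1
  exact (mEquiv M).commutes c

lemma dvd_const {p q : PP} (hp : p ≠ 0) (hq : q ≠ 0) (h : p ∣ q)
    (hd : q.totalDegree ≤ p.totalDegree) : ∃ c : k, q = C c * p := by
  obtain ⟨r, rfl⟩ := h
  have hr : r ≠ 0 := right_ne_zero_of_mul hq
  rw [totalDegree_mul_of_isDomain hp hr] at hd
  have : r.totalDegree = 0 := by omega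
  rw [totalDegree_eq_zero_iff_eq_C] at this
  exact ⟨coeff 0 r, by rw [mul_comm, ← this]⟩

lemma mEquiv_diag_totalDegree (χ : Fin N → (G →* kˣ)) (g : G) (p : PP) :
    (mEquiv (diagρ χ g) p).totalDegree ≤ p.totalDegree := by
  apply Finset.sup_mono
  intro a ha
  rw [mem_support_iff, mEquiv_diag_coeff] at ha
  rw [mem_support_iff]
  exact right_ne_zero_of_mul ha

/-- exponents of num and den differ by lattice vectors -/
lemma inLat_of_inv (χ : Fin N → (G →* kˣ)) (f₁ f₂ : PP) (h2 : f₂ ≠ 0) (h1 : f₁ ≠ 0)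
    (hrel : IsRelPrime f₁ f₂)
    (hinv : IsInv (diagρ χ) (algebraMap PP KK f₁ / algebraMap PP KK f₂))
    (a b : Fin N →₀ ℕ) (ha : a ∈ f₁.support) (hb : b ∈ f₂.support) :
    inLat χ (fun i => (a i : ℤ) - b i) := by
  intro g
  have h := hinv g
  set E := mEquiv (diagρ χ g) with hE
  rw [map_div₀, fAct_algMap, fAct_algMap, ← hE] at h
  have e1 : E f₁ ≠ 0 := by simpa using h1
  have e2 : E f₂ ≠ 0 := by simpa using h2
  have i2 : algebraMap PP KK f₂ ≠ 0 := by simpa using h2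
  have i2' : algebraMap PP KK (E f₂) ≠ 0 := by simpa using h2
  rw [div_eq_div_iff i2' i2, ← map_mul, ← map_mul] at h
  have h' := IsFractionRing.injective PP KK h
  have d1 : f₁ ∣ E f₁ := hrel.dvd_of_dvd_mul_right ⟨_, h'⟩
  obtain ⟨c, hc⟩ := dvd_const h1 e1 d1 (mEquiv_diag_totalDegree χ g f₁)
  have hc2 : E f₂ = C c * f₂ := by
    rw [hc] at h'
    apply mul_left_cancel₀ h1
    rw [← h']; ring
  have ca : (∏ i, (χ i g : k) ^ a i) = c := by
    have := mEquiv_diag_coeff χ g f₁ a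
    rw [← hE, hc, coeff_C_mul] at this
    exact (mul_right_cancel₀ (mem_support_iff.1 ha) this).symm
  have cb : (∏ i, (χ i g : k) ^ b i) = c := by
    have := mEquiv_diag_coeff χ g f₂ b
    rw [← hE, hc2, coeff_C_mul] at this
    exact (mul_right_cancel₀ (mem_support_iff.1 hb) this).symm
  have key : (∏ i, (χ i g) ^ a i) = ∏ i, (χ i g) ^ b i := by
    apply Units.ext
    push_cast
    rw [ca, cb]
  simp only [zpow_sub, Finset.prod_mul_distrib, Finset.prod_inv_distrib, zpow_natCast]
  rw [key, mul_inv_cancel]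

lemma algX_ne (i : Fin N) : algebraMap PP KK (X i) ≠ 0 := by simp

lemma laur_add (a b : Fin N → ℤ) : (laur (a + b) : KK) = laur a * laur b := by
  simp only [laur, ← Finset.prod_mul_distrib]
  exact Finset.prod_congr rfl fun i _ => zpow_add₀ (algX_ne i) _ _

lemma laur_neg (a : Fin N → ℤ) : (laur (-a) : KK) = (laur a)⁻¹ := by
  simp only [laur, ← Finset.prod_inv_distrib]
  exact Finset.prod_congr rfl fun i _ => by simp

lemma laur_zero : (laur (0 : Fin N → ℤ) : KK) = 1 := by simp [laur]

lemma laur_ne (a : Fin N → ℤ) : (laur a : KK) ≠ 0 :=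
  Finset.prod_ne_zero_iff.2 fun i _ => zpow_ne_zero _ (algX_ne i)

lemma laur_nat (a : Fin N →₀ ℕ) (c : k) :
    algebraMap PP KK (monomial a c) = algebraMap k KK c * laur (fun i => (a i : ℤ)) := by
  rw [monomial_eq, map_mul, Finsupp.prod_fintype _ _ (by simp), map_prod,
    IsScalarTower.algebraMap_apply k PP KK, MvPolynomial.algebraMap_eq]
  simp [laur]

lemma degZ_sub_le (a b : Fin N →₀ ℕ) (p q : PP) (ha : a ∈ p.support) (hb : b ∈ q.support) :
    degZ (fun i => (a i : ℤ) - b i) ≤ p.totalDegree + q.totalDegree := by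
  have h1 := le_totalDegree ha
  have h2 := le_totalDegree hb
  rw [Finsupp.sum_fintype _ _ (by simp)] at h1 h2
  refine le_trans ?_ (add_le_add h1 h2)
  rw [← Finset.sum_add_distrib]
  exact Finset.sum_le_sum fun i _ => by show ((a i : ℤ) - b i).natAbs ≤ _; omega

lemma sub_mem_of (F : IntermediateField k KK) (p : PP) (b : Fin N → ℤ)
    (h : ∀ a ∈ p.support, (laur (fun i => (a i : ℤ) - b i) : KK) ∈ F) :
    algebraMap PP KK p * laur (-b) ∈ F := by
  have e : algebraMap PP KK p * laur (-b) =
      ∑ a ∈ p.support, algebraMap PP KK (monomial a (coeff a p)) * laur (-b) := by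
    rw [← Finset.sum_mul, ← map_sum, ← p.as_sum]
  rw [e]
  refine sum_mem fun a ha => ?_
  rw [laur_nat, mul_assoc, ← laur_add]
  exact mul_mem (F.algebraMap_mem _) (h a ha)

lemma lemA (χ : Fin N → (G →* kˣ)) (f : KK) (d : ℕ) (hinv : IsInv (diagρ χ) f)
    (hd : RDegLE f d) (F : IntermediateField k KK)
    (hF : ∀ a, inLat χ a → degZ a ≤ d → (laur a : KK) ∈ F) : f ∈ F := by
  obtain ⟨f₁, f₂, h2, hrel, rfl, hd⟩ := hd
  by_cases h1 : f₁ = 0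
  · simp [h1]
  obtain ⟨a0, ha0⟩ := (support_nonempty).2 h1
  obtain ⟨b0, hb0⟩ := (support_nonempty).2 h2
  have key : ∀ a ∈ f₁.support, ∀ b ∈ f₂.support, (laur (fun i => (a i : ℤ) - b i) : KK) ∈ F :=
    fun a ha b hb => hF _ (inLat_of_inv χ f₁ f₂ h2 h1 (fun p hp hq => hrel p hp hq) hinv a b ha hb)
      ((degZ_sub_le a b _ _ ha hb).trans hd)
  have key' : ∀ a ∈ f₁.support, ∀ b ∈ f₂.support, (laur (fun i => (b i : ℤ) - a i) : KK) ∈ F := by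
    intro a ha b hb
    have := F.inv_mem (key a ha b hb)
    rw [← laur_neg] at this
    convert this using 2
    ext i; simp
  have m1 := sub_mem_of F f₁ (fun i => (b0 i : ℤ)) (fun a ha => key a ha b0 hb0)
  have m2 := sub_mem_of F f₂ (fun i => (a0 i : ℤ)) (fun b hb => key' a0 ha0 b hb)
  have m3 := key' a0 ha0 b0 hb0
  have e3 : (laur (fun i => (b0 i : ℤ) - a0 i) : KK) =
      laur (fun i => (b0 i : ℤ)) * (laur (fun i => (a0 i : ℤ)))⁻¹ := by
    rw [← laur_neg, ← laur_add]; congr 1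
  have := F.mul_mem (F.div_mem m1 m2) m3
  convert this using 1
  have i2 : algebraMap PP KK f₂ ≠ 0 := by simpa using h2
  rw [e3, laur_neg, laur_neg]
  have n1 := laur_ne (k := k) (fun i => (b0 i : ℤ))
  have n2 := laur_ne (k := k) (fun i => (a0 i : ℤ))
  field_simp

lemma rdeg_exists (f : KK) : ∃ d, RDegLE f d := by
  obtain ⟨a, b, hab, h⟩ := IsFractionRing.exists_reduced_fraction PP f
  exact ⟨_, a, b, nonZeroDivisors.ne_zero b.2, fun p hp hq => hab hp hq,
    by rw [← h, IsFractionRing.mk'_eq_div], le_rfl⟩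

lemma lemB1 (χ : Fin N → (G →* kˣ)) (a : Fin N → ℤ) (ha : inLat χ a) :
    IsInv (diagρ χ) (laur a : KK) := by
  intro g
  simp only [laur, map_prod, map_zpow₀, fAct_algMap, mEquiv_diag_X, map_mul, mul_zpow,
    Finset.prod_mul_distrib]
  have h := ha g
  have h2 : ∏ i, ((χ i g : k)) ^ (a i) = 1 := by
    have := congrArg (Units.val) h
    push_cast at this
    exact this
  have : ∏ i, (algebraMap PP KK (C (χ i g : k))) ^ (a i) = 1 := by
    have e : ∀ c : k, algebraMap PP KK (C c) = algebraMap k KK c := fun c => by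
      rw [IsScalarTower.algebraMap_apply k PP KK, MvPolynomial.algebraMap_eq]
    simp only [e, ← map_zpow₀, ← map_prod, h2, map_one]
  rw [this, one_mul]

lemma lemB2 (a : Fin N → ℤ) (d : ℕ) (hd : degZ a ≤ d) : RDegLE (laur a : KK) d := by
  refine ⟨∏ i, X i ^ (a i).toNat, ∏ i, X i ^ (-a i).toNat, ?_, ?_, ?_, ?_⟩
  · exact Finset.prod_ne_zero_iff.2 fun i _ => pow_ne_zero _ (X_ne_zero i)
  · have : IsRelPrime (∏ i, (X i : PP) ^ (a i).toNat) (∏ i, X i ^ (-a i).toNat) := by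
      apply IsRelPrime.prod_left
      intro i _
      apply IsRelPrime.prod_right
      intro j _
      by_cases hij : i = j
      · subst hij
        rcases le_total 0 (a i) with h | h
        · rw [show (-a i).toNat = 0 by omega, pow_zero]; exact isRelPrime_one_right
        · rw [show (a i).toNat = 0 by omega, pow_zero]; exact isRelPrime_one_left
      · apply IsRelPrime.pow
        rw [(X_prime (R := k) (i := i)).irreducible.isRelPrime_iff_not_dvd, X_dvd_X]
        exact hij
    exact fun p hp hq => this hp hq
  · rw [map_prod, map_prod, ← Finset.prod_div_distrib]
    refine Finset.prod_congr rfl fun i _ => ?_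
    rw [map_pow, map_pow, ← zpow_natCast, ← zpow_natCast, ← zpow_sub₀ (algX_ne i)]
    congr 1; omega
  · refine le_trans (add_le_add (totalDegree_finsetProd _ _) (totalDegree_finsetProd _ _)) ?_
    refine le_trans ?_ hd
    rw [← Finset.sum_add_distrib]
    refine Finset.sum_le_sum fun i _ => ?_
    rw [totalDegree_X_pow, totalDegree_X_pow]; omega

open LaurentPolynomial in
lemma transc (c : Fin N → ℤ) (i0 : Fin N) (hc : c i0 ≠ 0) (n : ℕ) (hn : 0 < n)
    (S : Set KK) (hS : ∀ f ∈ S, ∀ F : IntermediateField k KK,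
      (∀ a : Fin N → ℤ, ∑ i, c i * a i = 0 → (laur a : KK) ∈ F) → f ∈ F) :
    ¬ IsAlgebraic (IntermediateField.adjoin k S) (algebraMap PP KK (X i0) ^ n) := by
  let g0 : PP →+* KK[T;T⁻¹] :=
    eval₂Hom (LaurentPolynomial.C.comp (algebraMap k KK))
      (fun i => LaurentPolynomial.C (algebraMap PP KK (X i)) * T (c i))
  have hg0 : (LaurentPolynomial.eval₂ (RingHom.id KK) 1).comp g0 = algebraMap PP KK := by
    apply MvPolynomial.ringHom_ext
    · intro r
      simp [g0]
      rfl
    · intro i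
      simp [g0]
  have inj0 : Function.Injective g0 := by
    have : Function.Injective ((LaurentPolynomial.eval₂ (RingHom.id KK) 1).comp g0) := by
      rw [hg0]; exact IsFractionRing.injective PP KK
    rw [RingHom.coe_comp] at this
    exact Function.Injective.of_comp this
  let L := FractionRing KK[T;T⁻¹]
  have injL : Function.Injective (algebraMap KK[T;T⁻¹] L) := IsFractionRing.injective _ _
  have injc : Function.Injective ((algebraMap KK[T;T⁻¹] L).comp g0) := by
    rw [RingHom.coe_comp]; exact injL.comp inj0
  let φ : KK →+* L := IsFractionRing.lift (A := PP) (g := (algebraMap KK[T;T⁻¹] L).comp g0) injc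
  have hφ : ∀ p : PP, φ (algebraMap PP KK p) = algebraMap _ L (g0 p) := fun p =>
    IsFractionRing.lift_algebraMap injc p
  have hk : ∀ r : k, φ (algebraMap k KK r) = algebraMap KK L (algebraMap k KK r) := by
    intro r
    rw [IsScalarTower.algebraMap_apply k PP KK, hφ, MvPolynomial.algebraMap_eq]
    rw [IsScalarTower.algebraMap_apply KK KK[T;T⁻¹] L]
    simp [g0]
    rfl
  let t : L := algebraMap _ L (T 1 : KK[T;T⁻¹])
  have ht : ∀ j : ℤ, algebraMap _ L (T j : KK[T;T⁻¹]) = t ^ j := by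
    intro j
    obtain ⟨q, rfl | rfl⟩ := j.eq_nat_or_neg
    · rw [zpow_natCast, ← map_pow, T_pow, mul_one]
    · rw [zpow_neg, zpow_natCast, ← map_pow, T_pow, mul_one]
      apply eq_inv_of_mul_eq_one_left
      rw [← map_mul, ← T_add]; simp
  have hX : ∀ i, φ (algebraMap PP KK (X i)) = algebraMap KK L (algebraMap PP KK (X i)) * t ^ (c i) := by
    intro i
    rw [hφ, IsScalarTower.algebraMap_apply KK KK[T;T⁻¹] L, ← ht, ← map_mul]
    simp [g0]
  have t0 : t ≠ 0 := by
    intro h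
    have h1 := ht (-1)
    have : algebraMap _ L (T (-1) * T 1 : KK[T;T⁻¹]) = 0 := by
      rw [map_mul, h1]; change _ * t = 0; rw [h, mul_zero]
    rw [← T_add] at this; simp at this
  have hl : ∀ a : Fin N → ℤ, ∑ i, c i * a i = 0 → φ (laur a) = algebraMap KK L (laur a) := by
    intro a ha
    simp only [laur, map_prod, map_zpow₀, hX, mul_zpow, Finset.prod_mul_distrib, ← zpow_mul]
    have : ∏ i, t ^ (c i * a i) = t ^ (∑ i, c i * a i) := by
      generalize (Finset.univ : Finset (Fin N)) = U
      induction U using Finset.induction_on with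
      | empty => simp
      | insert x U hx ih => rw [Finset.prod_insert hx, Finset.sum_insert hx, zpow_add₀ t0, ih]
    rw [this, ha, zpow_zero, mul_one]
  let φk : KK →ₐ[k] L := 
    { φ with commutes' := fun r => (hk r).trans (IsScalarTower.algebraMap_apply k KK L r).symm }
  let E : IntermediateField k KK := 
    { AlgHom.equalizer φk (IsScalarTower.toAlgHom k KK L) with
      inv_mem' := by
        intro x hx
        have hx : φ x = algebraMap KK L x := hx
        change φ x⁻¹ = algebraMap KK L x⁻¹
        rw [map_inv₀, map_inv₀, hx] }
  have hE : IntermediateField.adjoin k S ≤ E := by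
    rw [IntermediateField.adjoin_le_iff]
    intro f hf
    exact hS f hf E hl
  rintro ⟨p, hp0, hp⟩
  let y : KK := algebraMap PP KK (X i0) ^ n
  have alg : IsAlgebraic KK (φ y) := by
    refine ⟨p.map (algebraMap _ KK), (Polynomial.map_ne_zero_iff Subtype.val_injective).2 hp0, ?_⟩
    have := congrArg φ hp
    rw [map_zero, Polynomial.aeval_def, Polynomial.hom_eval₂] at this
    rw [Polynomial.aeval_def, Polynomial.eval₂_map, ← this]
    congr 1
    ext z
    exact (hE z.2).symm
  have alg2 : IsAlgebraic KK (t ^ (c i0 * n)) := by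
    have y0 : y ≠ 0 := pow_ne_zero _ (algX_ne i0)
    have : t ^ (c i0 * n) = φ y * algebraMap KK L (y⁻¹) := by
      simp only [y, map_pow, hX, map_inv₀, mul_pow, zpow_mul, zpow_natCast]
      have : algebraMap KK L (algebraMap PP KK (X i0)) ≠ 0 := by simp
      rw [mul_right_comm, mul_inv_cancel₀ (pow_ne_zero _ this), one_mul]
    rw [this]
    exact alg.mul (isAlgebraic_algebraMap _)
  have alg3 : IsAlgebraic KK t := by
    rcases lt_or_gt_of_ne hc with h | h
    · have := alg2.inv
      rw [← zpow_neg, show -(c i0 * n) = (((-c i0).toNat * n : ℕ) : ℤ) by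
        push_cast; rw [Int.toNat_of_nonneg (by omega)]; ring, zpow_natCast] at this
      exact this.of_pow (Nat.mul_pos (by omega) hn)
    · rw [show (c i0 * n) = (((c i0).toNat * n : ℕ) : ℤ) by
        push_cast; rw [Int.toNat_of_nonneg (by omega)], zpow_natCast] at alg2
      exact alg2.of_pow (Nat.mul_pos (by omega) hn)
  rw [isAlgebraic_algebraMap_iff injL] at alg3
  have hT : (T 1 : KK[T;T⁻¹]) = Polynomial.toLaurentAlg (Polynomial.X) := by
    simp
  rw [hT, isAlgebraic_algHom_iff _ Polynomial.toLaurent_injective] at alg3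
  exact Polynomial.transcendental_X KK alg3

end helpers

section lattice

lemma degZ_add (a b : Fin N → ℤ) : degZ (a + b) ≤ degZ a + degZ b := by
  unfold degZ
  rw [← Finset.sum_add_distrib]
  exact Finset.sum_le_sum fun i _ => Int.natAbs_add_le _ _

lemma degZ_single (i : Fin N) (c : ℤ) : degZ (Pi.single i c) = c.natAbs := by
  unfold degZ
  rw [Finset.sum_eq_single i]
  · simp
  · intro j _ h; simp [Pi.single_eq_of_ne h]
  · simp

/-- integer weight -/
def wtZ (s : Fin N → ℤ) : (Fin N → ℤ) →+ ℤ where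
  toFun a := ∑ i, s i * a i
  map_zero' := by simp
  map_add' a b := by simp [mul_add, Finset.sum_add_distrib]

lemma wtZ_apply (s a : Fin N → ℤ) : wtZ s a = ∑ i, s i * a i := rfl

lemma wtZ_single (s : Fin N → ℤ) (i : Fin N) (c : ℤ) : wtZ s (Pi.single i c) = s i * c := by
  rw [wtZ_apply, Finset.sum_eq_single i]
  · simp
  · intro j _ h; simp [Pi.single_eq_of_ne h]
  · simp

lemma inLat_iff (n : ℕ) (ζ : kˣ) (hζ : IsPrimitiveRoot (ζ : k) n)
    (s : Fin N → ℤ) (χ : Fin N → (Multiplicative (ZMod n) →* kˣ))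
    (hχ : ∀ i, χ i (Multiplicative.ofAdd (1 : ZMod n)) = ζ ^ (s i)) (a : Fin N → ℤ) :
    inLat χ a ↔ (n : ℤ) ∣ wtZ s a := by
  have hζ' : IsPrimitiveRoot ζ n := IsPrimitiveRoot.coe_units_iff.1 hζ
  have h1 : ∏ i, (χ i (Multiplicative.ofAdd (1 : ZMod n))) ^ (a i) = ζ ^ (wtZ s a) := by
    simp only [hχ, ← zpow_mul, wtZ_apply]
    generalize (Finset.univ : Finset (Fin N)) = U
    induction U using Finset.induction_on with
    | empty => simp
    | insert x U hx ih => rw [Finset.prod_insert hx, Finset.sum_insert hx, zpow_add, ih]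
  rw [← hζ'.zpow_eq_one_iff_dvd, ← h1]
  constructor
  · intro h; exact h _
  · intro h g
    obtain ⟨l, hl⟩ := ZMod.intCast_surjective (Multiplicative.toAdd g)
    have hg : g = (Multiplicative.ofAdd (1 : ZMod n)) ^ l := by
      rw [← ofAdd_zsmul, zsmul_one, hl]; rfl
    rw [hg]
    simp only [map_zpow, ← zpow_mul, mul_comm l, ]
    simp only [zpow_mul, Finset.prod_zpow, h, one_zpow]

variable {m : ℕ}

lemma Sset_bound {m : ℕ} {v : ℤ} (h : v ∈ Sset m) : v.natAbs ≤ (m + 1) / 2 := by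
  unfold Sset at h
  split_ifs at h
  · have := h.2; omega
  · rcases h with h | h
    · have := h.2; omega
    · omega

lemma Sset_pos {m : ℕ} {v : ℕ} (h0 : 0 < v) (h : v ≤ (m + 1) / 2) : (v : ℤ) ∈ Sset m := by
  unfold Sset
  split_ifs
  · exact ⟨by omega, by omega⟩
  · by_cases h' : v = (m + 1) / 2
    · right; rw [h']
    · left; exact ⟨by omega, by omega⟩

lemma Sset_ne {m : ℕ} {v : ℤ} (h : v ∈ Sset m) : v ≠ 0 := by
  unfold Sset at h
  split_ifs at h
  · exact h.1
  · rcases h with h | h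
    · exact h.1
    · omega

lemma lemC (n m : ℕ) (hn : 3 ≤ n) (hm1 : 1 ≤ m) (s : Fin m → ℤ) (hrange : Set.range s = Sset m)
    (D : ℕ) (hD3 : 3 ≤ D) (hD : (n + (m + 1) / 2 - 1) / ((m + 1) / 2) ≤ D)
    (a : Fin m → ℤ) (ha : (n : ℤ) ∣ wtZ s a) :
    a ∈ AddSubgroup.closure {b : Fin m → ℤ | (n : ℤ) ∣ wtZ s b ∧ degZ b ≤ D} := by
  set H := AddSubgroup.closure {b : Fin m → ℤ | (n : ℤ) ∣ wtZ s b ∧ degZ b ≤ D} with hH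
  have hmem : ∀ b, (n : ℤ) ∣ wtZ s b → degZ b ≤ D → b ∈ H := fun b h1 h2 =>
    AddSubgroup.subset_closure ⟨h1, h2⟩
  set M := (m + 1) / 2 with hM
  have hMpos : 0 < M := by omega
  have hs : ∀ i, s i ∈ Sset m := fun i => hrange ▸ Set.mem_range_self i
  have hidx : ∀ v : ℕ, 0 < v → v ≤ M → ∃ i, s i = v := by
    intro v h0 h1
    have : (v : ℤ) ∈ Set.range s := by rw [hrange]; exact Sset_pos h0 h1
    exact this
  obtain ⟨i1, hi1⟩ := hidx 1 one_pos hMpos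
  have s3 : ∀ (x y z : Fin m) (p q r : ℤ), degZ (Pi.single x p + Pi.single y q + Pi.single z r)
      ≤ p.natAbs + q.natAbs + r.natAbs := by
    intro x y z p q r
    have h1 := degZ_add (Pi.single x p + Pi.single y q) (Pi.single z r)
    have h2 := degZ_add (Pi.single x p) (Pi.single y q)
    simp only [degZ_single] at h1 h2
    omega
  have hpos : ∀ v : ℕ, ∀ i, s i = (v + 1 : ℕ) →
      (Pi.single i 1 - Pi.single i1 (s i) : Fin m → ℤ) ∈ H := by
    intro v
    induction v with
    | zero =>
      intro i hi
      apply hmem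
      · rw [map_sub, wtZ_single, wtZ_single, hi1]; simp
      · have := s3 i i1 i1 1 (-1) 0
        rw [hi]
        simp only [Pi.single_neg, Pi.single_zero, add_zero, ← sub_eq_add_neg] at this
        simp only [zero_add, Nat.cast_one] 
        refine this.trans ?_
        simp; omega
    | succ v ih =>
      intro i hi
      have hb := Sset_bound (hs i)
      obtain ⟨j, hj⟩ := hidx (v + 1) (by omega) (by omega)
      have h1 := ih j hj
      have h2 : (Pi.single i 1 + Pi.single j (-1) + Pi.single i1 (-1) : Fin m → ℤ) ∈ H := by
        apply hmem
        · rw [map_add, map_add, wtZ_single, wtZ_single, wtZ_single, hi, hj, hi1]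
          push_cast; ring_nf; simp
        · exact (s3 _ _ _ _ _ _).trans (by simpa using hD3)
      convert H.add_mem h2 h1 using 1
      have : s i = 1 + s j := by rw [hi, hj]; push_cast; ring
      rw [this, Pi.single_add, Pi.single_neg, Pi.single_neg]
      abel
  have hall : ∀ i, (Pi.single i 1 - Pi.single i1 (s i) : Fin m → ℤ) ∈ H := by
    intro i
    have hb := Sset_bound (hs i)
    have h0 := Sset_ne (hs i)
    rcases lt_or_gt_of_ne h0 with h | h
    · obtain ⟨j, hj⟩ := hidx (s i).natAbs (by omega) hb
      have hj' : s j = - s i := by omega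
      have h1 := hpos ((s i).natAbs - 1) j (by rw [hj]; congr 1; omega)
      have h2 : (Pi.single i 1 + Pi.single j 1 + Pi.single i1 0 : Fin m → ℤ) ∈ H := by
        apply hmem
        · rw [map_add, map_add, wtZ_single, wtZ_single, wtZ_single, hj']
          simp
        · exact (s3 _ _ _ _ _ _).trans (by simp; omega)
      convert H.sub_mem h2 h1 using 1
      rw [hj', Pi.single_neg, Pi.single_zero]
      abel
    · exact hpos ((s i).natAbs - 1) i (by omega)
  have hred : ∀ b : Fin m → ℤ, b - Pi.single i1 (wtZ s b) ∈ H := by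
    intro b
    have e : b - Pi.single i1 (wtZ s b) =
        ∑ i, b i • (Pi.single i 1 - Pi.single i1 (s i) : Fin m → ℤ) := by
      simp only [smul_sub, Finset.sum_sub_distrib]
      congr 1
      · ext j; simp [Finset.sum_apply, Pi.single_apply]
      · ext j
        simp only [Finset.sum_apply, Pi.smul_apply, Pi.single_apply, smul_eq_mul, wtZ_apply]
        split_ifs
        · exact Finset.sum_congr rfl fun i _ => mul_comm _ _
        · simp
    rw [e]
    exact H.sum_mem fun i _ => H.zsmul_mem (hall i) _
  have hn1 : (Pi.single i1 (n : ℤ) : Fin m → ℤ) ∈ H := by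
    obtain ⟨iM, hiM⟩ := hidx M hMpos le_rfl
    have hdm := Nat.div_add_mod n M
    have hex : ∃ b : Fin m → ℤ, wtZ s b = n ∧ degZ b ≤ D := by
      by_cases hr : n % M = 0
      · refine ⟨Pi.single iM ((n / M : ℕ) : ℤ), ?_, ?_⟩
        · rw [wtZ_single, hiM]; rw [hr] at hdm; exact_mod_cast hdm
        · rw [degZ_single, Int.natAbs_natCast]
          refine le_trans (Nat.div_le_div_right ?_) hD
          omega
      · have hlt := Nat.mod_lt n hMpos
        obtain ⟨ir, hir⟩ := hidx (n % M) (by omega) hlt.le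
        refine ⟨Pi.single iM ((n / M : ℕ) : ℤ) + Pi.single ir 1, ?_, ?_⟩
        · rw [map_add, wtZ_single, wtZ_single, hiM, hir, mul_one]; exact_mod_cast hdm
        · refine (degZ_add _ _).trans ?_
          rw [degZ_single, degZ_single, Int.natAbs_natCast]
          refine le_trans ?_ hD
          rw [Nat.le_div_iff_mul_le hMpos]
          have : (n / M + Int.natAbs 1) * M = M * (n / M) + M := by simp; ring
          omega
    obtain ⟨b, hb, hbd⟩ := hex
    have h1 := hred b
    have h2 := hmem b (by rw [hb]) hbd
    rw [hb] at h1
    simpa using H.sub_mem h2 h1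
  obtain ⟨q, hq⟩ := ha
  have h1 := hred a
  have h2 : (Pi.single i1 (wtZ s a) : Fin m → ℤ) = q • Pi.single i1 (n : ℤ) := by
    rw [hq, ← Pi.single_smul, smul_eq_mul, mul_comm]
  rw [h2] at h1
  simpa using H.add_mem h1 (H.zsmul_mem hn1 q)

lemma degZ_peel (i0 : Fin N) (a : Fin N → ℤ) (d : ℕ) (h : degZ a ≤ d + 1) :
    ∃ i, ∃ ε : ℤ, (ε = 0 ∨ ε = 1 ∨ ε = -1) ∧ ∃ b, degZ b ≤ d ∧ a = Pi.single i ε + b := by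
  by_cases h0 : ∃ i, a i ≠ 0
  · obtain ⟨i, hi⟩ := h0
    refine ⟨i, (a i).sign, ?_, a - Pi.single i (a i).sign, ?_, by abel⟩
    · rcases lt_or_gt_of_ne hi with h | h
      · right; right; exact Int.sign_eq_neg_one_of_neg h
      · right; left; exact Int.sign_eq_one_of_pos h
    · unfold degZ at h ⊢
      rw [← Finset.add_sum_erase _ _ (Finset.mem_univ i)] at h ⊢
      have e : ∑ x ∈ Finset.univ.erase i, ((a - Pi.single i (a i).sign : Fin N → ℤ) x).natAbs =
          ∑ x ∈ Finset.univ.erase i, (a x).natAbs := by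
        refine Finset.sum_congr rfl fun x hx => ?_
        simp [Pi.single_eq_of_ne (Finset.ne_of_mem_erase hx)]
      rw [e]
      have : ((a - Pi.single i (a i).sign : Fin N → ℤ) i).natAbs + 1 = (a i).natAbs := by
        simp only [Pi.sub_apply, Pi.single_eq_same]
        rcases lt_or_gt_of_ne hi with h | h
        · rw [Int.sign_eq_neg_one_of_neg h]; omega
        · rw [Int.sign_eq_one_of_pos h]; omega
      omega
  · push Not at h0
    have : a = 0 := funext h0
    exact ⟨i0, 0, Or.inl rfl, 0, by simp [degZ], by simp [this]⟩

lemma lemD (n m : ℕ) (hn : 3 ≤ n) (hm1 : 1 ≤ m) (s : Fin m → ℤ) (hrange : Set.range s = Sset m)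
    (d : ℕ) (hd : d < max 3 ((n + (m + 1) / 2 - 1) / ((m + 1) / 2))) :
    ∃ c : Fin m → ℤ, ∃ i0, c i0 ≠ 0 ∧ ∀ a, (n : ℤ) ∣ wtZ s a → degZ a ≤ d →
      ∑ i, c i * a i = 0 := by
  have hs : ∀ i, s i ∈ Sset m := fun i => hrange ▸ Set.mem_range_self i
  obtain ⟨i1, hi1⟩ : ∃ i, s i = (1 : ℕ) := by
    have : ((1 : ℕ) : ℤ) ∈ Set.range s := by rw [hrange]; exact Sset_pos one_pos (by omega)
    exact this
  rcases lt_max_iff.1 hd with hd | hd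
  · haveI : Fact (2 < n) := ⟨by omega⟩
    have hne : (1 : ZMod n) ≠ -1 := (ZMod.neg_one_ne_one).symm
    have hne0 : (1 : ZMod n) ≠ 0 := by
      haveI : Fact (1 < n) := ⟨by omega⟩
      exact one_ne_zero
    let ψ : ZMod n → ℤ := fun z => if z = 1 then 1 else if z = -1 then -1 else 0
    have ψneg : ∀ z, ψ (-z) = - ψ z := by
      intro z
      simp only [ψ, neg_inj, neg_eq_iff_eq_neg]
      by_cases h1 : z = 1
      · simp [h1, hne]
      · by_cases h2 : z = -1 <;> simp [h1, h2, hne.symm]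
    have ψ0 : ψ 0 = 0 := by
      have := ψneg 0
      rw [neg_zero] at this; omega
    refine ⟨fun i => ψ (s i), i1, by simp [hi1, ψ], ?_⟩
    intro a ha had
    obtain ⟨i, ε, hε, b, hb, rfl⟩ := degZ_peel i1 a 1 (by omega)
    obtain ⟨j, δ, hδ, b, hb', rfl⟩ := degZ_peel i1 b 0 (by omega)
    have hb0 : b = 0 := by
      unfold degZ at hb'
      have := Finset.sum_eq_zero_iff.1 (Nat.le_zero.1 hb')
      funext x
      simpa using this x (Finset.mem_univ x)
    subst hb0
    have hz := (ZMod.intCast_zmod_eq_zero_iff_dvd (wtZ s _) n).2 ha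
    change wtZ (fun i => ψ (s i)) _ = 0
    simp only [map_add, wtZ_single, map_zero, add_zero] at hz ⊢
    push_cast at hz
    have k1 : ∀ z w : ZMod n, z + w = 0 → ψ z + ψ w = 0 := by
      intro z w h
      rw [eq_neg_of_add_eq_zero_left h, ψneg]; ring
    have ke : ∀ (v : ZMod n) (e : ℤ), (e = 0 ∨ e = 1 ∨ e = -1) → ψ v * e = ψ (v * (e : ℤ)) := by
      rintro v e (rfl | rfl | rfl) <;> simp [ψ0, ψneg]
    rw [ke _ _ hε, ke _ _ hδ]
    exact k1 _ _ hz
  · refine ⟨s, i1, by rw [hi1]; norm_num, ?_⟩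
    intro a ha had
    change wtZ s a = 0
    apply Int.eq_zero_of_abs_lt_dvd ha
    have hMpos : 0 < (m + 1) / 2 := by omega
    set M := (m + 1) / 2 with hM
    have h1 : |wtZ s a| ≤ (M : ℤ) * degZ a := by
      rw [wtZ_apply]
      refine (Finset.abs_sum_le_sum_abs _ _).trans ?_
      unfold degZ
      push_cast
      rw [Finset.mul_sum]
      refine Finset.sum_le_sum fun i _ => ?_
      rw [abs_mul]
      have := Sset_bound (hs i)
      exact mul_le_mul_of_nonneg_right (by rw [Int.abs_eq_natAbs]; exact_mod_cast this) (abs_nonneg _)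
    have h2 : (d + 1) * M ≤ n + M - 1 := (Nat.le_div_iff_mul_le hMpos).1 hd
    have h3 : M * degZ a ≤ M * d := Nat.mul_le_mul_left _ had
    have h4 : M * degZ a < n := by
      have : (d + 1) * M = M * d + M := by ring
      omega
    exact lt_of_le_of_lt h1 (by exact_mod_cast h4)

end lattice

lemma alg_all {N : ℕ} (F : IntermediateField k (FractionRing (MvPolynomial (Fin N) k)))
    (h : ∀ i, IsAlgebraic F (algebraMap (MvPolynomial (Fin N) k)
      (FractionRing (MvPolynomial (Fin N) k)) (X i)))
    (f : FractionRing (MvPolynomial (Fin N) k)) : IsAlgebraic F f := by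
  have hp : ∀ p : MvPolynomial (Fin N) k, IsAlgebraic F (algebraMap (MvPolynomial (Fin N) k)
      (FractionRing (MvPolynomial (Fin N) k)) p) := by
    intro p
    induction p using MvPolynomial.induction_on with
    | C a =>
      have : algebraMap (MvPolynomial (Fin N) k) (FractionRing (MvPolynomial (Fin N) k)) (C a)
        = algebraMap F _ (algebraMap k F a) := by
        rw [← IsScalarTower.algebraMap_apply k F, IsScalarTower.algebraMap_apply k
          (MvPolynomial (Fin N) k), MvPolynomial.algebraMap_eq]
      rw [this]
      exact isAlgebraic_algebraMap _
    | add p q hp hq => rw [map_add]; exact hp.add hq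
    | mul_X p i hp => rw [map_mul]; exact hp.mul (h i)
  obtain ⟨a, b, -, rfl⟩ := IsFractionRing.div_surjective (A := MvPolynomial (Fin N) k) f
  rw [div_eq_mul_inv]
  exact (hp a).mul (hp b).inv

/-- For `G = ℤ/nℤ` (`n ≥ 3`), `1 ≤ m < n`, and the diagonal representation
with character set `S_m` over a field with a primitive `n`-th root of unity (in coprime
characteristic), `β^r(G,S_m) = γ^r(G,S_m) = max(3, ⌈n/⌈m/2⌉⌉)`. -/
theorem stmt16 {k : Type} [Field k] (n m : ℕ) (hn : 3 ≤ n) (hm1 : 1 ≤ m) (hmn : m < n)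
    (hchar : (n : k) ≠ 0) (ζ : kˣ) (hζ : IsPrimitiveRoot (ζ : k) n)
    (s : Fin m → ℤ) (hinj : Function.Injective s) (hrange : Set.range s = Sset m)
    (χ : Fin m → (Multiplicative (ZMod n) →* kˣ))
    (hχ : ∀ i, χ i (Multiplicative.ofAdd (1 : ZMod n)) = ζ ^ (s i)) :
    betaR (diagρ χ) = max 3 ((n + (m + 1) / 2 - 1) / ((m + 1) / 2)) ∧
    gammaR (diagρ χ) = max 3 ((n + (m + 1) / 2 - 1) / ((m + 1) / 2)) := by
  set D := max 3 ((n + (m + 1) / 2 - 1) / ((m + 1) / 2)) with hD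
  have hlat := inLat_iff n ζ hζ s χ hχ
  have hgen : ∀ f, IsInv (diagρ χ) f →
      f ∈ IntermediateField.adjoin k {h | IsInv (diagρ χ) h ∧ RDegLE h D} := by
    intro f hf
    obtain ⟨d0, hd0⟩ := rdeg_exists f
    refine lemA χ f d0 hf hd0 _ ?_
    intro a ha had
    have := lemC n m hn hm1 s hrange D (le_max_left _ _) (le_max_right _ _) a ((hlat a).1 ha)
    clear ha had
    induction this using AddSubgroup.closure_induction with
    | mem b hb =>
      exact IntermediateField.subset_adjoin _ _ ⟨lemB1 χ b ((hlat b).2 hb.1), lemB2 b D hb.2⟩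
    | zero => rw [laur_zero]; exact one_mem _
    | add x y hx hy h1 h2 => rw [laur_add]; exact mul_mem h1 h2
    | neg x hx h1 => rw [laur_neg]; exact inv_mem h1
  have hpow : ∀ i, IsInv (diagρ χ) (algebraMap (MvPolynomial (Fin m) k)
      (FractionRing (MvPolynomial (Fin m) k)) (X i) ^ n) := by
    intro i
    have h1 : inLat χ (Pi.single i (n : ℤ)) := by
      rw [hlat, wtZ_single]; exact Dvd.intro_left _ rfl
    have h2 := lemB1 χ _ h1
    have h3 : (laur (Pi.single i (n : ℤ)) : FractionRing (MvPolynomial (Fin m) k)) =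
        algebraMap (MvPolynomial (Fin m) k) _ (X i) ^ n := by
      unfold laur
      rw [Finset.prod_eq_single i]
      · simp
      · intro j _ h; simp [Pi.single_eq_of_ne h]
      · simp
    rwa [h3] at h2
  have hlow : ∀ d, d < D → ∀ S : Set (FractionRing (MvPolynomial (Fin m) k)),
      (∀ f ∈ S, IsInv (diagρ χ) f ∧ RDegLE f d) →
      ¬ ∀ f, IsInv (diagρ χ) f → IsAlgebraic (IntermediateField.adjoin k S) f := by
    intro d hd S hS hall
    obtain ⟨c, i0, hc, hca⟩ := lemD n m hn hm1 s hrange d hd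
    refine transc c i0 hc n (by omega) S ?_ (hall _ (hpow i0))
    intro f hf F hF
    exact lemA χ f d (hS f hf).1 (hS f hf).2 F fun a ha had => hF a (hca a ((hlat a).1 ha) had)
  constructor
  · apply IsLeast.csInf_eq
    refine ⟨hgen, ?_⟩
    intro d hd
    by_contra hlt
    push Not at hlt
    refine hlow d hlt {h | IsInv (diagρ χ) h ∧ RDegLE h d} (fun f hf => hf) ?_
    intro f hf
    exact isAlgebraic_algebraMap
      (⟨f, hd f hf⟩ : IntermediateField.adjoin k {h | IsInv (diagρ χ) h ∧ RDegLE h d})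
  · apply IsLeast.csInf_eq
    constructor
    · set S := {h | IsInv (diagρ χ) h ∧ RDegLE h D} with hS
      have hF : ∀ f : FractionRing (MvPolynomial (Fin m) k),
          IsAlgebraic (IntermediateField.adjoin k S) f := by
        apply alg_all
        intro i
        have : IsAlgebraic (IntermediateField.adjoin k S) (algebraMap (MvPolynomial (Fin m) k)
            (FractionRing (MvPolynomial (Fin m) k)) (X i) ^ n) :=
          isAlgebraic_algebraMap
            (⟨_, hgen _ (hpow i)⟩ : IntermediateField.adjoin k S)
        exact this.of_pow (by omega)
      haveI : Algebra.IsAlgebraic (Algebra.adjoin k S) (FractionRing (MvPolynomial (Fin m) k)) :=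
        ⟨fun f => IntermediateField.isAlgebraic_adjoin_iff.1 (hF f)⟩
      obtain ⟨t, htS, ht⟩ := exists_isTranscendenceBasis_subset (R := k) S
      refine ⟨t, fun f hf => htS hf, ht.1, ?_⟩
      intro f _
      have := ht.isAlgebraic_field
      rw [Subtype.range_coe] at this
      exact this.isAlgebraic f
    · rintro d ⟨S, hS, -, hall⟩
      by_contra hlt
      push Not at hlt
      exact hlow d hlt S hS hall
end
end
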